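/- arXiv:1607.04529 — 3 statements merged into one kernel-verified Lean document; each statement's English description precedes it below -/
import Mathlib

section
/- Let (R,𝔪) be a Noetherian local ring, 𝔞 ⊊ R a proper ideal, and M a finite R-module with c = cd(𝔞,M) > 0. If x ∈ 𝔞 is a regular element (non-zerodivisor) on both M and D_R(H^c_𝔞(M)), then M is relative Cohen-Macaulay with respect to 𝔞 if and only if M/xM is relative Cohen-Macaulay with respect to 𝔞. -/
open CategoryTheory

noncomputable section

/-- The cohomological dimension `cd(𝔞, M)`: the supremum (in `ℕ`) of the set of
indices `i` with `H^i_𝔞(M) ≠ 0`, local cohomology being taken w.r.t. `𝔞`. -/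
def cohDim {R : Type} [CommRing R] (I : Ideal R) (M : Type) [AddCommGroup M] [Module R M] : ℕ :=
  sSup {i : ℕ | Nontrivial ((localCohomology I i).obj (ModuleCat.of R M))}

/-- `M` is relative Cohen-Macaulay w.r.t. `𝔞` if there is precisely one non-vanishing
local cohomology module of `M` w.r.t. `𝔞`. -/
def IsRelCM {R : Type} [CommRing R] (I : Ideal R) (M : Type) [AddCommGroup M] [Module R M] :
    Prop :=
  ∃ c : ℕ, ∀ i : ℕ, Nontrivial ((localCohomology I i).obj (ModuleCat.of R M)) ↔ i = c

/-- `f : K →ₗ[R] E` exhibits `E` as an injective hull of `K`: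
`E` is an injective module and `f` is an essential monomorphism. -/
structure IsInjectiveHull (R : Type) [CommRing R] {K E : Type} [AddCommGroup K] [Module R K]
    [AddCommGroup E] [Module R E] (f : K →ₗ[R] E) : Prop where
  injective : Module.Injective R E
  inj : Function.Injective f
  essential : ∀ N : Submodule R E, N ≠ ⊥ → N ⊓ LinearMap.range f ≠ ⊥

/-- `F` is the cohomological dimension filtration (cd-filtration) of `M` in the range
`0 ≤ i ≤ c`: `F i` is the largest submodule of `M` of cohomological dimension `≤ i`. -/
def IsCdFiltration {R : Type} [CommRing R] (I : Ideal R) {M : Type} [AddCommGroup M]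
    [Module R M] (c : ℕ) (F : ℕ → Submodule R M) : Prop :=
  ∀ i ≤ c, cohDim I (F i) ≤ i ∧ ∀ N : Submodule R M, cohDim I N ≤ i → N ≤ F i

/-- The `i`-th factor `M_i / M_{i-1}` of a filtration `F` of `M`. -/
def filtFactor {R : Type} [CommRing R] {M : Type} [AddCommGroup M] [Module R M]
    (F : ℕ → Submodule R M) (i : ℕ) : Type :=
  ↥(F i) ⧸ Submodule.comap (F i).subtype (F (i - 1))

instance {R : Type} [CommRing R] {M : Type} [AddCommGroup M] [Module R M]
    (F : ℕ → Submodule R M) (i : ℕ) : AddCommGroup (filtFactor F i) :=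
  inferInstanceAs (AddCommGroup (↥(F i) ⧸ Submodule.comap (F i).subtype (F (i - 1))))

instance {R : Type} [CommRing R] {M : Type} [AddCommGroup M] [Module R M]
    (F : ℕ → Submodule R M) (i : ℕ) : Module R (filtFactor F i) :=
  inferInstanceAs (Module R (↥(F i) ⧸ Submodule.comap (F i).subtype (F (i - 1))))

/-- `M` is a relative Cohen-Macaulay filtered (RCMF) module w.r.t. `𝔞`: every factor
`M_i/M_{i-1}` (`1 ≤ i ≤ c = cd(𝔞,M)`) of its cd-filtration is either zero or an
`i`-cohomological dimensional relative Cohen-Macaulay module w.r.t. `𝔞`. -/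
def IsRCMF {R : Type} [CommRing R] (I : Ideal R) (M : Type) [AddCommGroup M] [Module R M] :
    Prop :=
  ∀ F : ℕ → Submodule R M, IsCdFiltration I (cohDim I M) F →
    ∀ i : ℕ, 1 ≤ i → i ≤ cohDim I M →
      Subsingleton (filtFactor F i) ∨
        (IsRelCM I (filtFactor F i) ∧ cohDim I (filtFactor F i) = i)

end

noncomputable section
namespace LCaux
variable {R : Type} [CommRing R]

lemma iso_sq {C : Type*} [Category C] {A A' B B' : C} {a : A' ⟶ A} {e : A ≅ B} {e' : A' ≅ B'}
    {b : B' ⟶ B} (h : a ≫ e.hom = e'.hom ≫ b) : b ≫ e.inv = e'.inv ≫ a := by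
  rw [Iso.comp_inv_eq, Category.assoc, h, Iso.inv_hom_id_assoc]

lemma paste_sq {C : Type*} [Category C] {A B D A' B' D' : C} {a : A ⟶ A'} {b : B ⟶ B'} {c : D ⟶ D'}
    {p : A' ⟶ B'} {p' : B' ⟶ D'} {q : A ⟶ B} {q' : B ⟶ D} (h : a ≫ p = q ≫ b)
    (h' : b ≫ p' = q' ≫ c) : a ≫ (p ≫ p') = (q ≫ q') ≫ c := by
  rw [reassoc_of% h, h', Category.assoc]

/-- Hom of complexes -/
def homMap {K L : ChainComplex (ModuleCat.{0} R) ℕ} (φ : K ⟶ L) (Y : ModuleCat.{0} R) :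
    L.linearYonedaObj R Y ⟶ K.linearYonedaObj R Y :=
  (HomologicalComplex.unopFunctor _ _).map
    ((((linearYoneda R (ModuleCat.{0} R)).obj Y).rightOp.mapHomologicalComplex _).map φ).op

lemma isoExt_nat {X X' : ModuleCat.{0} R} (f : X ⟶ X') (P : ProjectiveResolution X)
    (Q : ProjectiveResolution X') (φ : P.complex ⟶ Q.complex)
    (comm : φ.f 0 ≫ Q.π.f 0 = P.π.f 0 ≫ f) (n : ℕ) (Y : ModuleCat.{0} R) :
    ((Ext R (ModuleCat.{0} R) n).map f.op).app Y ≫ (P.isoExt n Y).hom =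
      (Q.isoExt n Y).hom ≫ HomologicalComplex.homologyMap (homMap φ Y) n := by
  have h1 := ProjectiveResolution.isoLeftDerivedObj_inv_naturality f P Q φ comm
    ((linearYoneda R (ModuleCat.{0} R)).obj Y).rightOp n
  have h2 := congrArg Quiver.Hom.unop h1
  have h0 := HomologicalComplex.homologyOp_hom_naturality (homMap φ Y) n
  have h3 : ((HomologicalComplex.homologyMap (homMap φ Y) n).op ≫
      ((Q.complex.linearYonedaObj R Y).homologyOp n).inv) =
      ((P.complex.linearYonedaObj R Y).homologyOp n).inv ≫ HomologicalComplex.homologyMap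
        ((HomologicalComplex.opFunctor _ _).map (homMap φ Y).op) n := by
    exact iso_sq h0
  have h4 := congrArg Quiver.Hom.unop h3
  have h5 : ((Ext R (ModuleCat.{0} R) n).map f.op).app Y ≫ (P.isoLeftDerivedObj ((linearYoneda R (ModuleCat.{0} R)).obj Y).rightOp n).inv.unop = (Q.isoLeftDerivedObj ((linearYoneda R (ModuleCat.{0} R)).obj Y).rightOp n).inv.unop ≫ (HomologicalComplex.homologyMap
        ((HomologicalComplex.opFunctor _ _).map (homMap φ Y).op) n).unop := h2
  have h6 : (HomologicalComplex.homologyMap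
        ((HomologicalComplex.opFunctor _ _).map (homMap φ Y).op) n).unop ≫ ((P.complex.linearYonedaObj R Y).homologyOp n).inv.unop = ((Q.complex.linearYonedaObj R Y).homologyOp n).inv.unop ≫ HomologicalComplex.homologyMap (homMap φ Y) n := h4.symm
  exact paste_sq h5 h6


/-- class map for a short complex -/
def scMk (S : ShortComplex (ModuleCat.{0} R)) : LinearMap.ker S.g.hom →ₗ[R] S.homology :=
  (S.moduleCatCyclesIso.inv ≫ S.homologyπ).hom

lemma scMk_surj (S : ShortComplex (ModuleCat.{0} R)) : Function.Surjective (scMk S) := by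
  have : Epi (S.moduleCatCyclesIso.inv ≫ S.homologyπ) := inferInstance
  exact (ModuleCat.epi_iff_surjective _).1 this

lemma scMk_eq_zero (S : ShortComplex (ModuleCat.{0} R)) (z : LinearMap.ker S.g.hom) :
    scMk S z = 0 ↔ ∃ v : S.X₁, S.f.hom v = z.1 := by
  have h : scMk S = (S.moduleCatLeftHomologyData.π ≫ S.moduleCatLeftHomologyData.homologyIso.inv).hom := by
    rw [S.moduleCatLeftHomologyData.π_comp_homologyIso_inv]; rfl
  rw [h]
  change S.moduleCatLeftHomologyData.homologyIso.inv (S.moduleCatLeftHomologyData.π z) = 0 ↔ _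
  have inj : Function.Injective S.moduleCatLeftHomologyData.homologyIso.inv :=
    (ModuleCat.mono_iff_injective _).1 inferInstance
  rw [map_eq_zero_iff _ inj]
  erw [Submodule.Quotient.mk_eq_zero]
  rw [LinearMap.mem_range]
  constructor
  · rintro ⟨v, hv⟩; exact ⟨v, congrArg Subtype.val hv⟩
  · rintro ⟨v, hv⟩; exact ⟨v, Subtype.ext hv⟩

lemma scMk_nat {S T : ShortComplex (ModuleCat.{0} R)} (φ : S ⟶ T) (z : LinearMap.ker S.g.hom)
    (w : LinearMap.ker T.g.hom) (h : φ.τ₂.hom z.1 = w.1) :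
    (ShortComplex.homologyMap φ).hom (scMk S z) = scMk T w := by
  have e : ShortComplex.cyclesMap φ (S.moduleCatCyclesIso.inv z) = T.moduleCatCyclesIso.inv w := by
    have inj : Function.Injective T.iCycles := (ModuleCat.mono_iff_injective _).1 inferInstance
    apply inj
    rw [← ModuleCat.comp_apply, ShortComplex.cyclesMap_i, ModuleCat.comp_apply]
    erw [ShortComplex.moduleCatCyclesIso_inv_iCycles_apply, ShortComplex.moduleCatCyclesIso_inv_iCycles_apply]
    exact h
  change (ShortComplex.homologyMap φ) (S.homologyπ (S.moduleCatCyclesIso.inv z)) = T.homologyπ (T.moduleCatCyclesIso.inv w)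
  rw [← e, ← ModuleCat.comp_apply, ShortComplex.homologyπ_naturality, ModuleCat.comp_apply]

section
variable {X : ModuleCat.{0} R} (P : ProjectiveResolution X) (n : ℕ) (Y : ModuleCat.{0} R)

/-- cocycles -/
def cocyc (K : ChainComplex (ModuleCat.{0} R) ℕ) (n : ℕ) (Y : ModuleCat.{0} R) : Submodule R (K.X n ⟶ Y) where
  carrier := {z | K.d (n+1) n ≫ z = 0}
  add_mem' {a b} ha hb := by simp_all
  zero_mem' := by simp
  smul_mem' r a ha := by simp_all

lemma mem_cocyc {K : ChainComplex (ModuleCat.{0} R) ℕ} {n : ℕ} {Y : ModuleCat.{0} R} {z : K.X n ⟶ Y} :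
   z ∈ cocyc K n Y ↔ K.d (n+1) n ≫ z = 0 := Iff.rfl

lemma cocyc_iff (K : ChainComplex (ModuleCat.{0} R) ℕ) (n : ℕ) (Y : ModuleCat.{0} R) (z : K.X n ⟶ Y) :
   z ∈ cocyc K n Y ↔ z ∈ LinearMap.ker ((K.linearYonedaObj R Y).sc n).g.hom := by
  rw [mem_cocyc]
  change _ ↔ K.d ((ComplexShape.up ℕ).next n) n ≫ z = 0
  rw [CochainComplex.next]

/-- inclusion of cocycles -/
def incl (K : ChainComplex (ModuleCat.{0} R) ℕ) (n : ℕ) (Y : ModuleCat.{0} R) :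
    cocyc K n Y →ₗ[R] LinearMap.ker ((K.linearYonedaObj R Y).sc n).g.hom :=
  Submodule.inclusion (fun z hz => (cocyc_iff K n Y z).1 hz)

/-- The class -/
def cls : cocyc P.complex n Y →ₗ[R] ((Ext R (ModuleCat.{0} R) n).obj (Opposite.op X)).obj Y :=
  (P.isoExt n Y).inv.hom ∘ₗ scMk ((P.complex.linearYonedaObj R Y).sc n) ∘ₗ incl P.complex n Y

lemma cls_surj : Function.Surjective (cls P n Y) := by
  intro h
  obtain ⟨z, hz⟩ := scMk_surj _ ((P.isoExt n Y).hom.hom h)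
  refine ⟨⟨z.1, (cocyc_iff P.complex n Y z.1).2 z.2⟩, ?_⟩
  change (P.isoExt n Y).inv.hom (scMk _ z) = h
  rw [hz]; simp

lemma cls_eq_zero (z : cocyc P.complex n Y) :
    cls P n Y z = 0 ↔ ∃ v : P.complex.X (n-1) ⟶ Y, P.complex.d n (n-1) ≫ v = z.1 := by
  have inj : Function.Injective (P.isoExt (R := R) n Y).inv :=
    (ModuleCat.mono_iff_injective _).1 inferInstance
  change (P.isoExt n Y).inv _ = 0 ↔ _
  rw [map_eq_zero_iff _ inj]
  refine (scMk_eq_zero _ _).trans ?_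
  change (∃ v : P.complex.X ((ComplexShape.up ℕ).prev n) ⟶ Y, P.complex.d n _ ≫ v = z.1) ↔ _
  cases n
  · rw [CochainComplex.prev_nat_zero]
  · rw [CochainComplex.prev_nat_succ]; rfl

lemma comp_mem {K L : ChainComplex (ModuleCat.{0} R) ℕ} (φ : K ⟶ L) {n : ℕ} {Y : ModuleCat.{0} R} {z : L.X n ⟶ Y}
    (hz : z ∈ cocyc L n Y) : φ.f n ≫ z ∈ cocyc K n Y := by
  rw [mem_cocyc] at *
  rw [← φ.comm_assoc, hz, Limits.comp_zero]

variable {P n Y}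
lemma cls_nat {X' : ModuleCat.{0} R} (f : X ⟶ X')
    (Q : ProjectiveResolution X') (φ : P.complex ⟶ Q.complex)
    (comm : φ.f 0 ≫ Q.π.f 0 = P.π.f 0 ≫ f) (z : cocyc Q.complex n Y) :
    (((Ext R (ModuleCat.{0} R) n).map f.op).app Y).hom (cls Q n Y z) =
      cls P n Y ⟨φ.f n ≫ z.1, comp_mem φ z.2⟩ := by
  have inj : Function.Injective (P.isoExt (R := R) n Y).hom :=
    (ModuleCat.mono_iff_injective _).1 inferInstance
  apply inj
  have h := ConcreteCategory.congr_hom (isoExt_nat f P Q φ comm n Y) (cls Q n Y z)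
  rw [ModuleCat.comp_apply, ModuleCat.comp_apply] at h
  refine h.trans ?_
  have c : ∀ {X : ModuleCat.{0} R} (P : ProjectiveResolution X) (z), (P.isoExt n Y).hom (cls P n Y z) =
    scMk ((P.complex.linearYonedaObj R Y).sc n) (incl P.complex n Y z) := by
    intro X P z
    change (P.isoExt n Y).hom ((P.isoExt n Y).inv _) = _
    rw [← ModuleCat.comp_apply, Iso.inv_hom_id]; rfl
  rw [c, c]
  exact scMk_nat _ _ _ rfl
end

section colim
open Limits Opposite
variable (J : Ideal R) (i : ℕ) (Y : ModuleCat.{0} R)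

/-- chosen resolution of `R/J^t` -/
def res (t : ℕ) : ProjectiveResolution
    ((localCohomology.ringModIdeals (localCohomology.idealPowersDiagram J)).obj (op t)) :=
  projectiveResolution _

/-- transition maps -/
def trans {t s : ℕ} (h : t ≤ s) : (res J s).complex ⟶ (res J t).complex :=
  ProjectiveResolution.lift ((localCohomology.ringModIdeals
    (localCohomology.idealPowersDiagram J)).map (homOfLE h).op) _ _

/-- the structure maps of the colimit -/
def colimInc (t : ℕ) : ((Ext R (ModuleCat.{0} R) i).obj (op
    ((localCohomology.ringModIdeals (localCohomology.idealPowersDiagram J)).obj (op t)))).obj Y →ₗ[R]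
    (localCohomology J i).obj Y :=
  ((colimit.ι (localCohomology.diagram (localCohomology.idealPowersDiagram J) i) (op (op t))).app Y).hom

/-- The class in local cohomology -/
def lcMk (t : ℕ) : cocyc (res J t).complex i Y →ₗ[R] (localCohomology J i).obj Y :=
  colimInc J i Y t ∘ₗ cls (res J t) i Y

/-- the evaluated colimit cocone -/
def evCol : IsColimit (((evaluation _ _).obj Y).mapCocone (colimit.cocone
    (localCohomology.diagram (localCohomology.idealPowersDiagram J) i))) :=
  isColimitOfPreserves _ (colimit.isColimit _)

variable {i Y}

lemma diag_map {t s : ℕ} (f : (op (op t) : (ℕᵒᵖ)ᵒᵖ) ⟶ op (op s)) (h : t ≤ s) (z : cocyc (res J t).complex i Y) :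
    ((localCohomology.diagram (localCohomology.idealPowersDiagram J) i).map f).app Y
      (cls (res J t) i Y z) = cls (res J s) i Y ⟨(trans J h).f i ≫ z.1, comp_mem _ z.2⟩ := by
  have : f = ((homOfLE h).op).op := Subsingleton.elim _ _
  subst this
  exact cls_nat (P := res J s) _ (res J t) (trans J h) (ProjectiveResolution.lift_commutes_zero _ _ _) z

lemma lcMk_trans {t s : ℕ} (h : t ≤ s) (z : cocyc (res J t).complex i Y) :
    lcMk J i Y s ⟨(trans J h).f i ≫ z.1, comp_mem _ z.2⟩ = lcMk J i Y t z := by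
  change colimInc J i Y s (cls (res J s) i Y _) = _
  rw [← diag_map J ((homOfLE h).op).op h z]
  have := congrArg (fun f => NatTrans.app f Y) (colimit.w (localCohomology.diagram (localCohomology.idealPowersDiagram J) i) ((homOfLE h).op).op)
  exact ConcreteCategory.congr_hom this (cls (res J t) i Y z)

lemma lcMk_surj (h : (localCohomology J i).obj Y) : ∃ t z, lcMk J i Y t z = h := by
  obtain ⟨j, y, hy⟩ := Concrete.isColimit_exists_rep _ (evCol J i Y) h
  obtain ⟨z, hz⟩ := cls_surj (res J j.unop.unop) i Y y
  refine ⟨j.unop.unop, z, ?_⟩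
  rw [← hy, ← hz]
  rfl

lemma lcMk_eq_zero (t : ℕ) (z : cocyc (res J t).complex i Y) : lcMk J i Y t z = 0 ↔
    ∃ (s : ℕ) (h : t ≤ s) (v : (res J s).complex.X (i-1) ⟶ Y),
      (res J s).complex.d i (i-1) ≫ v = (trans J h).f i ≫ z.1 := by
  constructor
  · intro h
    obtain ⟨k, f, g, hfg⟩ := (Concrete.isColimit_rep_eq_iff_exists _ (evCol J i Y)
      (i := op (op t)) (j := op (op t)) (cls (res J t) i Y z) (0 : _)).1 (h.trans (map_zero (lcMk J i Y t)).symm |>.trans (by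
        rw [map_zero]; exact (map_zero (((colimit.ι (localCohomology.diagram (localCohomology.idealPowersDiagram J) i) (op (op t))).app Y).hom)).symm))
    have hts : t ≤ k.unop.unop := leOfHom f.unop.unop
    have h2 := diag_map J (s := k.unop.unop) f hts z
    have h3 : cls (res J k.unop.unop) i Y ⟨(trans J hts).f i ≫ z.1, comp_mem _ z.2⟩ = 0 := by
      rw [← h2]; exact hfg.trans (map_zero (((localCohomology.diagram (localCohomology.idealPowersDiagram J) i).map g).app Y).hom)
    obtain ⟨v, hv⟩ := (cls_eq_zero _ _ _ _).1 h3
    exact ⟨_, hts, v, hv⟩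
  · rintro ⟨s, h, v, hv⟩
    rw [← lcMk_trans J h]
    change colimInc J i Y s (cls (res J s) i Y _) = _
    rw [(cls_eq_zero (res J s) i Y ⟨(trans J h).f i ≫ z.1, comp_mem _ z.2⟩).2 ⟨v, hv⟩, map_zero]

lemma smul_id_comm {A B : ModuleCat.{0} R} (r : R) (p : A ⟶ B) : (r • 𝟙 A) ≫ p = p ≫ (r • 𝟙 B) := by
  simp

lemma lcMk_tors (t : ℕ) (r : R) (hr : r ∈ J ^ t) (z : cocyc (res J t).complex i Y) :
    r • lcMk J i Y t z = 0 := by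
  have hz : (r • 𝟙 ((localCohomology.ringModIdeals (localCohomology.idealPowersDiagram J)).obj (op t))) = 0 := by
    ext y
    obtain ⟨y, rfl⟩ := Submodule.Quotient.mk_surjective _ y
    change r • (Submodule.Quotient.mk y : R ⧸ J ^ t) = 0
    rw [← Submodule.Quotient.mk_smul]
    exact (Submodule.Quotient.mk_eq_zero _).2 (Ideal.mul_mem_right y _ hr)
  have h1 := cls_nat (P := res J t) (r • 𝟙 _) (res J t) (r • 𝟙 _) (smul_id_comm _ _) z
  have h2 := cls_nat (P := res J t) (0) (res J t) (0) (zero_comp.trans comp_zero.symm) z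
  rw [hz] at h1
  have h3 := h1.symm.trans h2
  have e1 : (⟨(r • 𝟙 (res J t).complex : (res J t).complex ⟶ _).f i ≫ z.1, comp_mem _ z.2⟩ : cocyc (res J t).complex i Y) = r • z := by
    ext1; simp
  have e2 : (⟨(0 : (res J t).complex ⟶ (res J t).complex).f i ≫ z.1, comp_mem _ z.2⟩ : cocyc (res J t).complex i Y) = 0 := by
    ext1; simp
  rw [e1, e2, map_zero] at h3
  rw [← map_smul]
  change colimInc J i Y t (cls (res J t) i Y _) = _
  rw [h3, map_zero]

end colim

section chase
open Limits
variable (J : Ideal R) {i : ℕ} {M N : ModuleCat.{0} R}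

lemma lcMk_of_cob {Y : ModuleCat.{0} R} (t : ℕ) (z : cocyc (res J t).complex i Y)
    (v : (res J t).complex.X (i-1) ⟶ Y) (hv : (res J t).complex.d i (i-1) ≫ v = z.1) :
    lcMk J i Y t z = 0 := by
  change colimInc J i Y t (cls (res J t) i Y _) = _
  rw [(cls_eq_zero (res J t) i Y z).2 ⟨v, hv⟩, map_zero]

lemma lcMk_surj_ge {Y : ModuleCat.{0} R} (h : (localCohomology J i).obj Y) (t : ℕ) :
    ∃ (s : ℕ) (_ : t ≤ s) (z : _), lcMk J i Y s z = h := by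
  obtain ⟨s, z, rfl⟩ := lcMk_surj J h
  exact ⟨max t s, le_max_left _ _, _, lcMk_trans J (le_max_right t s) z⟩

/-- data of a short exact sequence `M → M → N` given by multiplication by `x` -/
structure XSeq (x : R) (q : M ⟶ N) : Prop where
  reg : IsSMulRegular M x
  surj : Function.Surjective q
  ker : ∀ m : M, q m = 0 → ∃ m' : M, m = x • m'
  zero : ∀ m : M, q (x • m) = 0

variable {x : R} {q : M ⟶ N}

lemma XSeq.cancel (H : XSeq x q) {A : ModuleCat.{0} R} {a b : A ⟶ M} (h : x • a = x • b) : a = b := by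
  ext y
  exact H.reg (ConcreteCategory.congr_hom h y)

lemma XSeq.div (H : XSeq x q) {A : ModuleCat.{0} R} (a : A ⟶ M) (h : a ≫ q = 0) :
    ∃ b : A ⟶ M, a = x • b := by
  have h' : ∀ y : A, ∃ m : M, a y = x • m := fun y => H.ker _ (ConcreteCategory.congr_hom h y)
  choose b hb using h'
  refine ⟨ModuleCat.ofHom ⟨⟨b, ?_⟩, ?_⟩, ?_⟩
  · intro y z
    apply H.reg
    change x • b (y + z) = x • (b y + b z)
    rw [smul_add, ← hb, ← hb, ← hb, map_add]
  · intro r y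
    apply H.reg
    change x • b (r • y) = x • (r • b y)
    rw [smul_comm, ← hb, ← hb, map_smul]
  · ext y
    exact hb y

lemma XSeq.comp (H : XSeq x q) {A : ModuleCat.{0} R} (a : A ⟶ M) : (x • a) ≫ q = 0 := by
  ext y
  exact H.zero (a y)

lemma XSeq.lift (H : XSeq x q) {A : ModuleCat.{0} R} [Projective A] (a : A ⟶ N) :
    ∃ b : A ⟶ M, b ≫ q = a := by
  have : Epi q := (ModuleCat.epi_iff_surjective _).2 H.surj
  exact ⟨Projective.factorThru a q, by simp⟩

lemma XSeq.inj_of_zero (H : XSeq x q) (h0 : ∀ h : (localCohomology J i).obj N, h = 0)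
    (h : (localCohomology J (i+1)).obj M) (hx : x • h = 0) : h = 0 := by
  obtain ⟨t, z, rfl⟩ := lcMk_surj J h
  rw [← map_smul] at hx
  obtain ⟨s, hts, v, hv⟩ : ∃ (s : ℕ) (h : t ≤ s) (v : (res J s).complex.X i ⟶ M),
      (res J s).complex.d (i+1) i ≫ v = (trans J h).f (i+1) ≫ (x • z).1 :=
    (lcMk_eq_zero J _ _).1 hx
  rw [← lcMk_trans J hts]
  generalize hz1 : (⟨(trans J hts).f (i+1) ≫ z.1, comp_mem _ z.2⟩ :
    cocyc (res J s).complex (i+1) M) = z1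
  have hv1 : (res J s).complex.d (i+1) i ≫ v = x • z1.1 := by
    rw [hv, ← hz1]; simp
  have hw : v ≫ q ∈ cocyc (res J s).complex i N := by
    rw [mem_cocyc, ← Category.assoc, hv1, H.comp]
  obtain ⟨s', hss, v', hv'⟩ := (lcMk_eq_zero J s ⟨v ≫ q, hw⟩).1 (h0 _)
  obtain ⟨v'', rfl⟩ := H.lift v'
  obtain ⟨u, hu⟩ := H.div ((trans J hss).f i ≫ v - (res J s').complex.d i (i-1) ≫ v'') (by
    rw [Preadditive.sub_comp, Category.assoc, Category.assoc, hv', sub_self])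
  rw [← lcMk_trans J hss]
  refine lcMk_of_cob J s' _ u ?_
  apply H.cancel
  change x • ((res J s').complex.d (i+1) i ≫ u) = x • ((trans J hss).f (i+1) ≫ z1.1)
  rw [← Linear.comp_smul, ← hu, ← Linear.comp_smul, ← hv1, Preadditive.comp_sub]
  simp

lemma XSeq.inj_zero (H : XSeq x q) 
    (h : (localCohomology J 0).obj M) (hx : x • h = 0) : h = 0 := by
  obtain ⟨t, z, rfl⟩ := lcMk_surj J h
  rw [← map_smul] at hx
  obtain ⟨s, hts, v, hv⟩ := (lcMk_eq_zero J _ _).1 hx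
  rw [← lcMk_trans J hts]
  refine lcMk_of_cob J s _ 0 ?_
  apply H.cancel
  rw [(res J s).complex.shape _ _ (by simp), zero_comp] at hv
  rw [comp_zero, smul_zero, hv]
  simp

lemma XSeq.zero_of (H : XSeq x q) 
    (hs : ∀ h : (localCohomology J i).obj M, ∃ h', h = x • h')
    (hi : ∀ h : (localCohomology J (i+1)).obj M, x • h = 0 → h = 0)
    (h : (localCohomology J i).obj N) : h = 0 := by
  obtain ⟨t, z, rfl⟩ := lcMk_surj J h
  obtain ⟨z1, hz1⟩ := H.lift z.1
  obtain ⟨w, hw⟩ := H.div ((res J t).complex.d (i+1) i ≫ z1) (by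
    rw [Category.assoc, hz1]; exact z.2)
  have hwc : w ∈ cocyc (res J t).complex (i+1) M := by
    rw [mem_cocyc]
    apply H.cancel
    rw [← Linear.comp_smul, ← hw]; simp
  have hw0 : lcMk J (i+1) M t ⟨w, hwc⟩ = 0 := by
    apply hi
    rw [← map_smul]
    exact lcMk_of_cob J t _ z1 hw
  obtain ⟨s, hts, u, hu⟩ : ∃ (s : ℕ) (h : t ≤ s) (u : (res J s).complex.X i ⟶ M),
      (res J s).complex.d (i+1) i ≫ u = (trans J h).f (i+1) ≫ w :=
    (lcMk_eq_zero J _ _).1 hw0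
  have hy : (trans J hts).f i ≫ z1 - x • u ∈ cocyc (res J s).complex i M := by
    rw [mem_cocyc, Preadditive.comp_sub, Linear.comp_smul, hu, ← HomologicalComplex.Hom.comm_assoc, hw]
    simp
  obtain ⟨h', hh'⟩ := hs (lcMk J i M s ⟨_, hy⟩)
  obtain ⟨s', hss, y, rfl⟩ := lcMk_surj_ge J h' s
  rw [← lcMk_trans J hss, ← map_smul, ← sub_eq_zero, ← map_sub] at hh'
  obtain ⟨s2, hs2, v, hv⟩ := (lcMk_eq_zero J _ _).1 hh'
  rw [← lcMk_trans J hts, ← lcMk_trans J hss, ← lcMk_trans J hs2]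
  refine lcMk_of_cob J s2 _ (v ≫ q) ?_
  rw [← Category.assoc, hv]
  simp only [Submodule.coe_sub, Submodule.coe_smul, Preadditive.comp_sub, Preadditive.sub_comp,
    Category.assoc, hz1, Linear.comp_smul, H.comp, sub_zero]
  
lemma tors (h : (localCohomology J i).obj M) (hx : x ∈ J)
    (hi : ∀ h : (localCohomology J i).obj M, x • h = 0 → h = 0) : h = 0 := by
  have aux : ∀ (t : ℕ) (h : (localCohomology J i).obj M), x ^ t • h = 0 → h = 0 := by
    intro t
    induction t with
    | zero => intro h h1; simpa using h1
    | succ t ih => exact fun h h1 => ih h (hi _ (by rwa [smul_smul, ← pow_succ']))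
  obtain ⟨t, z, rfl⟩ := lcMk_surj J h
  exact aux t _ (lcMk_tors J t (x ^ t) (Ideal.pow_mem_pow hx t) z)
end chase

/-- Matlis: the injective hull of the residue field cogenerates. -/
lemma surj_of_dual [IsLocalRing R] {E : Type} [AddCommGroup E] [Module R E]
    (f : IsLocalRing.ResidueField R →ₗ[R] E) (hinj : Module.Injective R E)
    (hf : Function.Injective f) {H : Type} [AddCommGroup H] [Module R H] (x : R)
    (hx : IsSMulRegular (H →ₗ[R] E) x) (h : H) : ∃ h', h = x • h' := by
  by_contra hcon
  let S : Submodule R H := LinearMap.range (LinearMap.lsmul R H x)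
  have hS : h ∉ S := fun ⟨h', e⟩ => hcon ⟨h', e.symm⟩
  let g : R →ₗ[R] H ⧸ S := LinearMap.toSpanSingleton R _ (S.mkQ h)
  have hk : LinearMap.ker g ≤ IsLocalRing.maximalIdeal R := by
    apply IsLocalRing.le_maximalIdeal
    intro ht
    have : (1 : R) ∈ LinearMap.ker g := ht ▸ Submodule.mem_top
    apply hS
    rw [← Submodule.Quotient.mk_eq_zero]
    simpa [g] using this
  let p : (R ⧸ LinearMap.ker g) →ₗ[R] E := f ∘ₗ (Submodule.mapQ _ _ LinearMap.id hk)
  let j : (R ⧸ LinearMap.ker g) →ₗ[R] H ⧸ S := (LinearMap.ker g).liftQ g le_rfl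
  have hj : Function.Injective j := by
    rw [← LinearMap.ker_eq_bot]; exact Submodule.ker_liftQ_eq_bot _ _ _ le_rfl
  obtain ⟨ψ, hψ⟩ := hinj.out j hj p
  have h0 : ψ ∘ₗ S.mkQ = 0 := by
    apply hx
    ext y
    change x • ψ (S.mkQ y) = x • 0
    rw [smul_zero, ← map_smul, ← map_smul, (Submodule.Quotient.mk_eq_zero S).2 ⟨y, rfl⟩ |> fun e => (show S.mkQ (x • y) = 0 from e), map_zero]
  have h1 := hψ (Submodule.Quotient.mk 1)
  have h2 : j (Submodule.Quotient.mk 1) = S.mkQ h := by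
    change g 1 = _
    simp [g]
  rw [h2, show ψ (S.mkQ h) = (ψ ∘ₗ S.mkQ) h from rfl, h0] at h1
  have h3 : p (Submodule.Quotient.mk 1) = f 1 := rfl
  rw [h3] at h1
  have := hf (h1.symm.trans (map_zero f).symm)
  exact one_ne_zero this
end LCaux
end

/-- Corollary 2.11(i): for `x ∈ 𝔞` regular on both `M` and `D_R(H^c_𝔞(M))`,
`M` is relative Cohen-Macaulay w.r.t. `𝔞` iff `M/xM` is. -/
theorem stmt1 {R : Type} [CommRing R] [IsNoetherianRing R] [IsLocalRing R]
    (𝔞 : Ideal R) (h𝔞 : 𝔞 ≠ ⊤)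
    (M : Type) [AddCommGroup M] [Module R M] [Module.Finite R M]
    (c : ℕ) (hc : c = cohDim 𝔞 M) (hc0 : 0 < c)
    (E : Type) [AddCommGroup E] [Module R E]
    (f : IsLocalRing.ResidueField R →ₗ[R] E) (hE : IsInjectiveHull R f)
    (x : R) (hx : x ∈ 𝔞)
    (hxM : IsSMulRegular M x)
    (hxD : IsSMulRegular (((localCohomology 𝔞 c).obj (ModuleCat.of R M)) →ₗ[R] E) x) :
    IsRelCM 𝔞 M ↔ IsRelCM 𝔞 (M ⧸ (Ideal.span {x} • ⊤ : Submodule R M)) := by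
  have hsurj := LCaux.surj_of_dual f hE.injective hE.inj x hxD
  let q : ModuleCat.of R M ⟶ ModuleCat.of R (M ⧸ (Ideal.span {x} • ⊤ : Submodule R M)) :=
    ModuleCat.ofHom (Submodule.mkQ _)
  have H : LCaux.XSeq x q := by
    refine ⟨hxM, Submodule.mkQ_surjective _, fun m hm => ?_, fun m => ?_⟩
    · have := (Submodule.Quotient.mk_eq_zero _).1 hm
      rw [Submodule.ideal_span_singleton_smul] at this
      obtain ⟨m', -, e⟩ := this
      exact ⟨m', e.symm⟩
    · refine (Submodule.Quotient.mk_eq_zero _).2 ?_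
      exact Submodule.smul_mem_smul (Ideal.mem_span_singleton_self x) trivial
  have hbdd : BddAbove {i : ℕ | Nontrivial ((localCohomology 𝔞 i).obj (ModuleCat.of R M))} := by
    by_contra hb
    rw [cohDim, Nat.sSup_of_not_bddAbove hb] at hc
    omega
  have hne : {i : ℕ | Nontrivial ((localCohomology 𝔞 i).obj (ModuleCat.of R M))}.Nonempty := by
    by_contra hb
    rw [Set.not_nonempty_iff_eq_empty] at hb
    rw [cohDim, hb, csSup_empty] at hc
    simp at hc
    omega
  have hcn : Nontrivial ((localCohomology 𝔞 c).obj (ModuleCat.of R M)) := by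
    rw [hc]; exact Nat.sSup_mem hne hbdd
  have hgt : ∀ i, c < i → ∀ h : (localCohomology 𝔞 i).obj (ModuleCat.of R M), h = 0 := by
    intro i hi h
    by_contra h0
    have : i ≤ c := by rw [hc]; exact le_csSup hbdd (show Nontrivial _ from ⟨h, 0, h0⟩)
    omega
  have key : ∀ {i : ℕ} {Y : ModuleCat.{0} R}, ¬ Nontrivial ((localCohomology 𝔞 i).obj Y) →
      ∀ h : (localCohomology 𝔞 i).obj Y, h = 0 := by
    intro i Y hn h
    by_contra h0
    exact hn ⟨h, 0, h0⟩
  have key' : ∀ {i : ℕ} {Y : ModuleCat.{0} R}, 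
      (∀ h : (localCohomology 𝔞 i).obj Y, h = 0) → ¬ Nontrivial ((localCohomology 𝔞 i).obj Y) := by
    rintro i Y h0 ⟨a, b, hab⟩
    exact hab ((h0 a).trans (h0 b).symm)
  obtain ⟨d, rfl⟩ : ∃ d, c = d + 1 := ⟨c - 1, by omega⟩
  have hd : Nontrivial ((localCohomology 𝔞 d).obj
      (ModuleCat.of R (M ⧸ (Ideal.span {x} • ⊤ : Submodule R M)))) := by
    by_contra hn
    exact key' (fun h => LCaux.tors 𝔞 h hx (H.inj_of_zero 𝔞 (key hn))) hcn
  constructor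
  · rintro ⟨c', hc'⟩
    obtain rfl := (hc' _).1 hcn
    refine ⟨d, fun i => ⟨fun hi => ?_, ?_⟩⟩
    · by_contra hid
      refine key' (H.zero_of 𝔞 (fun h => ?_) (fun h _ => ?_)) hi
      · by_cases e : i = d + 1
        · subst e; exact hsurj h
        · exact ⟨0, by rw [smul_zero]; exact key (fun h => e ((hc' i).1 h)) h⟩
      · exact key (fun h => hid (by have := (hc' _).1 h; omega)) h
    · rintro rfl; exact hd
  · rintro ⟨d', hd'⟩
    obtain rfl := (hd' _).1 hd
    refine ⟨d + 1, fun i => ⟨fun hi => ?_, ?_⟩⟩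
    · by_contra hid
      refine key' (fun h => LCaux.tors 𝔞 h hx ?_) hi
      cases i with
      | zero => exact H.inj_zero 𝔞
      | succ j =>
        exact H.inj_of_zero 𝔞 (key (fun h => hid (by rw [(hd' _).1 h])))
    · rintro rfl; exact hcn
end

section
/- Let (R,𝔪) be a Noetherian local ring, 𝔞 ⊊ R a proper ideal, and M a finite R-module with c = cd(𝔞,M) > 0. If x₁,…,xₙ ∈ 𝔞 is a regular sequence on both M and D_R(H^c_𝔞(M)), then M is relative Cohen-Macaulay with respect to 𝔞 if and only if M/(x₁,…,xₙ)M is relative Cohen-Macaulay with respect to 𝔞. -/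
open CategoryTheory

noncomputable section
namespace LC
open CategoryTheory Limits Opposite
variable {R : Type} [CommRing R]

section generic
variable (K : ChainComplex (ModuleCat.{0} R)ᵒᵖ ℕ) (n : ℕ)

lemma gi_inj : Function.Injective (K.pOpcycles n).unop := by
  rw [← ModuleCat.mono_iff_injective]
  infer_instance

lemma gq_surj : Function.Surjective (K.homologyι n).unop := by
  rw [← ModuleCat.epi_iff_surjective]
  infer_instance

lemma gi_range (f : (K.X n).unop) :
    (∃ z, (K.pOpcycles n).unop z = f) ↔ (K.d (n+1) n).unop f = 0 := by
  have h := (ShortComplex.exact_of_g_is_cokernel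
    (ShortComplex.mk _ _ (K.d_pOpcycles (n+1) n))
    (K.opcyclesIsCokernel (n+1) n (by simp))).unop
  rw [ShortComplex.ShortExact.moduleCat_exact_iff_function_exact] at h
  exact (h f).symm

lemma gq_ker (z : (K.opcycles n).unop) :
    (K.homologyι n).unop z = 0 ↔ ∃ g : (K.X ((ComplexShape.down ℕ).next n)).unop,
      (K.pOpcycles n).unop z = (K.d n _).unop g := by
  have h := (ShortComplex.exact_of_f_is_kernel
    (ShortComplex.mk _ _ (K.homologyι_comp_fromOpcycles n _))
    (K.homologyIsKernel n _ rfl)).unop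
  rw [ShortComplex.ShortExact.moduleCat_exact_iff_function_exact] at h
  refine (h z).trans (exists_congr fun g => ?_)
  have h2 : (K.pOpcycles n).unop ((K.fromOpcycles n ((ComplexShape.down ℕ).next n)).unop g) =
    (K.d n _).unop g := by
    rw [← K.p_fromOpcycles n ((ComplexShape.down ℕ).next n)]; rfl
  constructor
  · rintro hg
    rw [← h2, ← hg]; rfl
  · rintro hg
    apply gi_inj K n
    exact h2.trans hg.symm

end generic

abbrev MC (R : Type) [CommRing R] := ModuleCat.{0} R

abbrev yF (Y : MC R) : MC R ⥤ (MC R)ᵒᵖ := ((linearYoneda R (MC R)).obj Y).rightOp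

def L {X : MC R} (P : ProjectiveResolution X) (Y : MC R) : ChainComplex (MC R)ᵒᵖ ℕ :=
  ((yF Y).mapHomologicalComplex _).obj P.complex

def Lm {X X' : MC R} {P : ProjectiveResolution X} {P' : ProjectiveResolution X'} 
  (φ : P.complex ⟶ P'.complex) (Y : MC R) : L P Y ⟶ L P' Y :=
  ((yF Y).mapHomologicalComplex _).map φ

def LI {X : MC R} (P : ProjectiveResolution X) (Y : MC R) (n : ℕ) : 
    ((yF Y).leftDerived n).obj X ≅ (L P Y).homology n := P.isoLeftDerivedObj (yF Y) n

abbrev EXT (n : ℕ) (X Y : MC R) : MC R := ((Ext R (MC R) n).obj (op X)).obj Y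

/-- cocycles -/
def CC {X : MC R} (P : ProjectiveResolution X) (Y : MC R) (n : ℕ) : MC R :=
   ((L P Y).opcycles n).unop 

/-- cocycle inclusion -/
def iC {X : MC R} (P : ProjectiveResolution X) (Y : MC R) (n : ℕ) :
    CC P Y n →ₗ[R] (P.complex.X n ⟶ Y) :=
  ((L P Y).pOpcycles n).unop.hom

def qC {X : MC R} (P : ProjectiveResolution X) (Y : MC R) (n : ℕ) :
    CC P Y n →ₗ[R] EXT n X Y :=
  (((L P Y).homologyι n).unop ≫ (LI P Y n).hom.unop).hom

lemma LI_inj {X : MC R} (P : ProjectiveResolution X) (Y : MC R) (n : ℕ) : 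
    Function.Bijective (LI P Y n).hom.unop := by
  constructor
  · rw [← ModuleCat.mono_iff_injective]
    infer_instance
  · rw [← ModuleCat.epi_iff_surjective]
    infer_instance

lemma iC_inj {X : MC R} (P : ProjectiveResolution X) (Y : MC R) (n : ℕ) :
    Function.Injective (iC P Y n) := gi_inj _ _

lemma qC_surj {X : MC R} (P : ProjectiveResolution X) (Y : MC R) (n : ℕ) :
    Function.Surjective (qC P Y n) := (LI_inj P Y n).2.comp (gq_surj (L P Y) n)

lemma iC_range {X : MC R} (P : ProjectiveResolution X) (Y : MC R) (n : ℕ) (f : P.complex.X n ⟶ Y) :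
    (∃ z, iC P Y n z = f) ↔ P.complex.d (n+1) n ≫ f = 0 := gi_range (L P Y) n f

lemma qC_ker {X : MC R} (P : ProjectiveResolution X) (Y : MC R) (n : ℕ) (z) :
    qC P Y n z = 0 ↔ ∃ g : P.complex.X ((ComplexShape.down ℕ).next n) ⟶ Y,
      iC P Y n z = P.complex.d n _ ≫ g := by
  refine Iff.trans ?_ (gq_ker (L P Y) n z)
  exact ⟨fun h => (LI_inj P Y n).1 (h.trans (map_zero (LI P Y n).hom.unop.hom).symm), fun h => 
    (congrArg (LI P Y n).hom.unop h).trans (map_zero (LI P Y n).hom.unop.hom)⟩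

lemma qC_nat {X X' : MC R} (P : ProjectiveResolution X) (P' : ProjectiveResolution X') (Y : MC R)
    (n : ℕ) (f : X ⟶ X') (φ : P.complex ⟶ P'.complex) (comm : φ.f 0 ≫ P'.π.f 0 = P.π.f 0 ≫ f)
    (z z') (hz : iC P Y n z = φ.f n ≫ iC P' Y n z') :
    ((Ext R (MC R) n).map f.op).app Y (qC P' Y n z') = qC P Y n z := by
  let w := (HomologicalComplex.opcyclesMap (Lm φ Y) n).unop
  have hw : z = w z' := by
    apply iC_inj
    rw [hz]
    have := HomologicalComplex.p_opcyclesMap (Lm φ Y) n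
    exact (congrArg (fun k => k.unop z') this).symm
  subst hw
  have h1 : ((yF Y).leftDerived n).map f ≫ (LI P' Y n).hom =
      (LI P Y n).hom ≫ HomologicalComplex.homologyMap (Lm φ Y) n := 
        P.isoLeftDerivedObj_hom_naturality f P' φ comm (yF Y) n
  have h2 := HomologicalComplex.homologyι_naturality (Lm φ Y) n
  have h3 : ((yF Y).leftDerived n).map f ≫ ((LI P' Y n).hom ≫ (L P' Y).homologyι n)
    = ((LI P Y n).hom ≫ (L P Y).homologyι n) ≫ 
      HomologicalComplex.opcyclesMap (Lm φ Y) n := by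
    rw [← Category.assoc, h1, Category.assoc, Category.assoc, ← h2]
  exact congrArg (fun k => k.unop z') h3


open localCohomology

variable (I : Ideal R)

abbrev PR (t : ℕ) : ProjectiveResolution (ModuleCat.of R (R ⧸ I ^ t) : MC R) :=
  projectiveResolution _

abbrev Hh (i : ℕ) (Y : MC R) : MC R := (localCohomology I i).obj Y

def trM {s t : ℕ} (h : t ≤ s) : (ModuleCat.of R (R ⧸ I ^ s) : MC R) ⟶ ModuleCat.of R (R ⧸ I ^ t) :=
  (ringModIdeals (idealPowersDiagram I)).map (homOfLE h).op

def cl (i : ℕ) (Y : MC R) (t : ℕ) : EXT i (ModuleCat.of R (R ⧸ I ^ t)) Y ⟶ Hh I i Y :=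
  (colimit.ι (diagram (idealPowersDiagram I) i) (op (op t))).app Y

lemma cl_tr (i : ℕ) (Y : MC R) {s t : ℕ} (h : t ≤ s) (e : EXT i (ModuleCat.of R (R ⧸ I ^ t)) Y) :
    cl I i Y s (((Ext R (MC R) i).map (trM I h).op).app Y e) = cl I i Y t e := by
  have := colimit.w (diagram (idealPowersDiagram I) i) (homOfLE h).op.op
  exact congrArg (fun k => (k.app Y) e) this

def clIs (i : ℕ) (Y : MC R) := isColimitOfPreserves ((evaluation (MC R) (MC R)).obj Y)
  (colimit.isColimit (diagram (idealPowersDiagram I) i))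

lemma cl_surj (i : ℕ) (Y : MC R) (h : Hh I i Y) : ∃ t e, cl I i Y t e = h := by
  obtain ⟨t, e, he⟩ := Concrete.isColimit_exists_rep _ (clIs I i Y) h
  exact ⟨t.unop.unop, e, he⟩

lemma cl_ker (i : ℕ) (Y : MC R) (t : ℕ) (e) (h : cl I i Y t e = 0) :
    ∃ s, ∃ hs : t ≤ s, ((Ext R (MC R) i).map (trM I hs).op).app Y e = 0 := by
  have h0 : cl I i Y t e = cl I i Y t 0 := h.trans (map_zero (cl I i Y t).hom).symm
  obtain ⟨k, f, g, hfg⟩ := Concrete.isColimit_exists_of_rep_eq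
    (diagram (idealPowersDiagram I) i ⋙ (evaluation (MC R) (MC R)).obj Y) (clIs I i Y)
    (i := op (op t)) (j := op (op t)) e (0 : EXT i (ModuleCat.of R (R ⧸ I ^ t)) Y) h0
  refine ⟨k.unop.unop, leOfHom f.unop.unop, ?_⟩
  exact hfg.trans (map_zero (((diagram (idealPowersDiagram I) i) ⋙ (evaluation (MC R) (MC R)).obj Y).map g).hom)

/-- `φ` lifts the transition map. -/
def IsLift {s t : ℕ} (φ : (PR I s).complex ⟶ (PR I t).complex) : Prop :=
  ∃ h : t ≤ s, φ.f 0 ≫ (PR I t).π.f 0 = (PR I s).π.f 0 ≫ trM I h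

lemma exists_lift {s t : ℕ} (h : t ≤ s) :
    ∃ φ : (PR I s).complex ⟶ (PR I t).complex, IsLift I φ :=
  ⟨ProjectiveResolution.lift (trM I h) _ _, h, ProjectiveResolution.lift_commutes_zero _ _ _⟩

def Rep (i : ℕ) (Y : MC R) (t : ℕ) (f : (PR I t).complex.X i ⟶ Y) (h : Hh I i Y) : Prop :=
  ∃ z, iC (PR I t) Y i z = f ∧ cl I i Y t (qC (PR I t) Y i z) = h

variable {I} {i : ℕ} {Y : MC R}

lemma rep_surj (h : Hh I i Y) : ∃ t f, Rep I i Y t f h := by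
  obtain ⟨t, e, rfl⟩ := cl_surj I i Y h
  obtain ⟨z, rfl⟩ := qC_surj (PR I t) _ _ e
  exact ⟨t, _, z, rfl, rfl⟩

lemma Rep.cocycle {t f h} (H : Rep I i Y t f h) : (PR I t).complex.d (i+1) i ≫ f = 0 := by
  obtain ⟨z, h1, h2⟩ := H
  exact (iC_range _ _ _ _).1 ⟨z, h1⟩

lemma rep_exists {t} {f : (PR I t).complex.X i ⟶ Y} (hf : (PR I t).complex.d (i+1) i ≫ f = 0) :
    ∃ h, Rep I i Y t f h := by
  obtain ⟨z, hz⟩ := (iC_range _ _ _ _).2 hf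
  exact ⟨_, z, hz, rfl⟩

lemma Rep.add {t f h f' h'} (H : Rep I i Y t f h) (H' : Rep I i Y t f' h') :
    Rep I i Y t (f + f') (h + h') := by
  obtain ⟨z, rfl, rfl⟩ := H
  obtain ⟨z', rfl, rfl⟩ := H'
  exact ⟨z + z', map_add _ _ _, by simp⟩

lemma Rep.smul {t f h} (r : R) (H : Rep I i Y t f h) : Rep I i Y t (r • f) (r • h) := by
  obtain ⟨z, rfl, rfl⟩ := H
  exact ⟨r • z, map_smul _ _ _, by simp⟩

lemma Rep.sub {t f h f' h'} (H : Rep I i Y t f h) (H' : Rep I i Y t f' h') :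
    Rep I i Y t (f - f') (h - h') := by
  obtain ⟨z, rfl, rfl⟩ := H
  obtain ⟨z', rfl, rfl⟩ := H'
  exact ⟨z - z', map_sub _ _ _, by simp⟩

lemma Rep.unique {t f h h'} (H : Rep I i Y t f h) (H' : Rep I i Y t f h') : h = h' := by
  obtain ⟨z, rfl, rfl⟩ := H
  obtain ⟨z', hz, rfl⟩ := H'
  rw [iC_inj _ _ _ hz]

lemma Rep.bdry {t h} {g : (PR I t).complex.X ((ComplexShape.down ℕ).next i) ⟶ Y}
    (H : Rep I i Y t ((PR I t).complex.d i _ ≫ g) h) : h = 0 := by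
  obtain ⟨z, hz, rfl⟩ := H
  rw [(qC_ker _ _ _ _).2 ⟨g, hz⟩, map_zero]

lemma Rep.trans {s t f h} (H : Rep I i Y t f h) {φ : (PR I s).complex ⟶ (PR I t).complex}
    (hφ : IsLift I φ) : Rep I i Y s (φ.f i ≫ f) h := by
  have hc := H.cocycle
  obtain ⟨z, rfl, rfl⟩ := H
  obtain ⟨z', hz'⟩ := (iC_range (PR I s) Y i (φ.f i ≫ iC _ _ _ z)).2 (by
    rw [← Category.assoc, ← φ.comm, Category.assoc, hc, comp_zero])
  obtain ⟨hle, comm⟩ := hφ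
  refine ⟨z', hz', ?_⟩
  rw [← qC_nat _ _ _ _ (trM I hle) φ comm z' z hz', cl_tr]

lemma Rep.zero {t f} (H : Rep I i Y t f 0) : ∃ s, ∃ φ : (PR I s).complex ⟶ (PR I t).complex,
    IsLift I φ ∧ ∃ g : (PR I s).complex.X ((ComplexShape.down ℕ).next i) ⟶ Y,
      φ.f i ≫ f = (PR I s).complex.d i _ ≫ g := by
  have hc := H.cocycle
  obtain ⟨z, rfl, h0⟩ := H
  obtain ⟨s, hs, h1⟩ := cl_ker _ _ _ _ _ h0
  obtain ⟨φ, hφ⟩ := exists_lift I hs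
  refine ⟨s, φ, hφ, ?_⟩
  obtain ⟨z', hz'⟩ := (iC_range (PR I s) Y i (φ.f i ≫ iC _ _ _ z)).2 (by
    rw [← Category.assoc, ← φ.comm, Category.assoc, hc, comp_zero])
  obtain ⟨hle, comm⟩ := hφ
  rw [qC_nat _ _ _ _ (trM I hle) φ comm z' z hz', qC_ker] at h1
  rwa [← hz']

lemma Rep.torsion {t f h} (H : Rep I i Y t f h) {r : R} (hr : r ∈ I ^ t) : r • h = 0 := by
  obtain ⟨z, rfl, rfl⟩ := H
  rw [← map_smul, ← map_smul]
  have h0 : (r • 𝟙 (PR I t).complex).f 0 ≫ (PR I t).π.f 0 = (PR I t).π.f 0 ≫ 0 := by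
    have key : ∀ (Q : MC R) (q : Q ⟶ ModuleCat.of R (R ⧸ I ^ t)), (r • 𝟙 Q) ≫ q = q ≫ 0 := by
      intro Q q
      rw [comp_zero, Linear.smul_comp, Category.id_comp]
      apply ModuleCat.hom_ext
      refine LinearMap.ext fun p => ?_
      change r • (q p : R ⧸ I ^ t) = 0
      obtain ⟨y, hy⟩ := Ideal.Quotient.mk_surjective (q p : R ⧸ I ^ t)
      rw [← hy]
      exact Ideal.Quotient.eq_zero_iff_mem.2 (Ideal.mul_mem_right _ _ hr)
    exact key _ _
  have e1 := qC_nat (PR I t) (PR I t) Y i 0 (r • 𝟙 _) h0 (r • z) z (by simp)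
  have e2 := qC_nat (PR I t) (PR I t) Y i 0 0 (zero_comp.trans comp_zero.symm) 0 z (by simp)
  rw [← e1, e2, map_zero, map_zero]

lemma Rep.bdry' {t h} {g : (PR I t).complex.X i ⟶ Y}
    (H : Rep I (i+1) Y t ((PR I t).complex.d (i+1) i ≫ g) h) : h = 0 := by
  have key : ∀ j (hj : (ComplexShape.down ℕ).next (i+1) = j) (g : (PR I t).complex.X j ⟶ Y)
    (_ : Rep I (i+1) Y t ((PR I t).complex.d (i+1) j ≫ g) h), h = 0 := by
    intro j hj
    subst hj
    exact fun g => Rep.bdry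
  exact key i (by simp) g H

lemma Rep.zero' {t f} (H : Rep I (i+1) Y t f 0) :
    ∃ s, ∃ φ : (PR I s).complex ⟶ (PR I t).complex,
    IsLift I φ ∧ ∃ g : (PR I s).complex.X i ⟶ Y,
      φ.f (i+1) ≫ f = (PR I s).complex.d (i+1) i ≫ g := by
  obtain ⟨s, φ, hφ, h⟩ := H.zero
  refine ⟨s, φ, hφ, ?_⟩
  have key : ∀ j (hj : (ComplexShape.down ℕ).next (i+1) = j),
    ∃ g : (PR I s).complex.X j ⟶ Y,
      φ.f (i+1) ≫ f = (PR I s).complex.d (i+1) j ≫ g := by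
    intro j hj
    subst hj
    exact h
  exact key i (by simp)

section ses
open scoped Pointwise

variable {M : Type} [AddCommGroup M] [Module R M] {x : R}

abbrev Yb (x : R) (M : Type) [AddCommGroup M] [Module R M] : MC R := ModuleCat.of R (QuotSMulTop x M)

def pb (x : R) (M : Type) [AddCommGroup M] [Module R M] : (ModuleCat.of R M : MC R) ⟶ Yb x M :=
  ModuleCat.ofHom (Submodule.mkQ _)

instance : Epi (pb x M) := by
  rw [ModuleCat.epi_iff_surjective]
  exact Submodule.mkQ_surjective _

lemma smul_pb {Q : MC R} (f : Q ⟶ ModuleCat.of R M) : (x • f) ≫ pb x M = 0 := by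
  apply ModuleCat.hom_ext
  refine LinearMap.ext fun p => ?_
  change (Submodule.mkQ (x • ⊤ : Submodule R M)) (x • f p) = 0
  rw [Submodule.mkQ_apply, Submodule.Quotient.mk_eq_zero]
  exact Submodule.smul_mem_pointwise_smul _ _ _ trivial

lemma ker_pb (hx : IsSMulRegular M x) {Q : MC R} (f : Q ⟶ ModuleCat.of R M) (hf : f ≫ pb x M = 0) :
    ∃ k, f = x • k := by
  have h1 : ∀ p, ∃ m : M, x • m = f p := by
    intro p
    have : (Submodule.mkQ (x • ⊤ : Submodule R M)) (f p) = 0 := by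
      change (f ≫ pb x M) p = 0
      rw [hf]; rfl
    rw [Submodule.mkQ_apply, Submodule.Quotient.mk_eq_zero,
      Submodule.mem_smul_pointwise_iff_exists] at this
    obtain ⟨m, -, hm⟩ := this
    exact ⟨m, hm⟩
  choose k hk using h1
  refine ⟨ModuleCat.ofHom { toFun := k, map_add' := ?_, map_smul' := ?_ }, ?_⟩
  · intro a b
    apply hx
    change x • _ = x • _
    rw [smul_add, hk, hk, hk, map_add]
  · intro r b
    apply hx
    change x • _ = x • (r • _)
    rw [smul_comm, hk, hk, map_smul]
  · apply ModuleCat.hom_ext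
    exact LinearMap.ext fun p => (hk p).symm

lemma reg_hom (hx : IsSMulRegular M x) {Q : MC R} {f g : Q ⟶ ModuleCat.of R M} (h : x • f = x • g) :
    f = g := by
  apply ModuleCat.hom_ext
  refine LinearMap.ext fun p => ?_
  apply hx
  exact congrArg (fun k => k.hom p) h

variable (I) in
def Conn (x : R) (M : Type) [AddCommGroup M] [Module R M] (i : ℕ) (a : Hh I i (Yb x M)) (b : Hh I (i+1) (ModuleCat.of R M)) : Prop :=
  ∃ (t : ℕ) (g : (PR I t).complex.X i ⟶ ModuleCat.of R M)
    (f : (PR I t).complex.X (i+1) ⟶ ModuleCat.of R M),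
    Rep I i (Yb x M) t (g ≫ pb x M) a ∧ Rep I (i+1) _ t f b ∧
      (PR I t).complex.d (i+1) i ≫ g = x • f

variable {a : Hh I i (Yb x M)} {b : Hh I (i+1) (ModuleCat.of R M)}

lemma conn_total (hx : IsSMulRegular M x) (a : Hh I i (Yb x M)) : ∃ b, Conn I x M i a b := by
  obtain ⟨t, f, hf⟩ := rep_surj a
  have := (PR I t).projective i
  obtain ⟨g, rfl⟩ : ∃ g, g ≫ pb x M = f := ⟨Projective.factorThru f (pb x M), by simp⟩
  obtain ⟨k, hk⟩ := ker_pb hx ((PR I t).complex.d (i+1) i ≫ g) (by simpa using hf.cocycle)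
  obtain ⟨b, hb⟩ := rep_exists (I := I) (t := t) (i := i+1) (f := k) (by
    apply reg_hom hx
    rw [smul_zero, ← Linear.comp_smul, ← hk]
    simp)
  exact ⟨b, t, g, k, hf, hb, hk⟩

lemma Conn.ker (H : Conn I x M i a b) : x • b = 0 := by
  obtain ⟨t, g, f, h1, h2, h3⟩ := H
  have := h2.smul x
  rw [← h3] at this
  exact this.bdry'

lemma conn_surj (b : Hh I (i+1) (ModuleCat.of R M)) (hb : x • b = 0) : ∃ a, Conn I x M i a b := by
  obtain ⟨t, f, hf⟩ := rep_surj b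
  have h2 := hf.smul x
  rw [hb] at h2
  obtain ⟨s, φ, hφ, g, hg⟩ := h2.zero'
  obtain ⟨a, ha⟩ := rep_exists (I := I) (t := s) (i := i) (f := g ≫ pb x M) (by
    rw [← Category.assoc, ← hg, Linear.comp_smul, smul_pb])
  exact ⟨a, s, g, _, ha, hf.trans hφ, by rw [← hg, Linear.comp_smul]⟩

lemma comm_d {s t : ℕ} (φ : (PR I s).complex ⟶ (PR I t).complex) {Y : MC R}
    (g : (PR I t).complex.X i ⟶ Y) :
    (PR I s).complex.d (i+1) i ≫ φ.f i ≫ g = φ.f (i+1) ≫ (PR I t).complex.d (i+1) i ≫ g := by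
  rw [← Category.assoc, ← φ.comm, Category.assoc]

lemma conn_zero_left (hx : IsSMulRegular M x) (H : Conn I x M i 0 b) : b = 0 := by
  obtain ⟨t, g, f, h1, h2, h3⟩ := H
  obtain ⟨s, φ, hφ, h, hh⟩ := h1.zero
  have := (PR I s).projective ((ComplexShape.down ℕ).next i)
  obtain ⟨h, rfl⟩ : ∃ h', h' ≫ pb x M = h := ⟨Projective.factorThru h (pb x M), by simp⟩
  obtain ⟨k, hk⟩ := ker_pb hx (φ.f i ≫ g - (PR I s).complex.d i _ ≫ h) (by
    rw [Preadditive.sub_comp, Category.assoc, Category.assoc, hh, sub_self])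
  have h4 : φ.f (i+1) ≫ f = (PR I s).complex.d (i+1) i ≫ k := by
    apply reg_hom hx
    rw [← Linear.comp_smul, ← Linear.comp_smul, ← h3, ← hk, Preadditive.comp_sub, comm_d]
    simp
  have := h2.trans hφ
  rw [h4] at this
  exact this.bdry'

lemma conn_zero_right (hs : ∀ h : Hh I i (ModuleCat.of R M), ∃ h', x • h' = h)
    (H : Conn I x M i a 0) : a = 0 := by
  obtain ⟨t, g, f, h1, h2, h3⟩ := H
  obtain ⟨s, φ, hφ, k, hk⟩ := h2.zero'
  obtain ⟨h, hh⟩ := rep_exists (I := I) (t := s) (i := i) (f := φ.f i ≫ g - x • k) (by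
    rw [Preadditive.comp_sub, comm_d, h3, Linear.comp_smul, Linear.comp_smul, hk, sub_self])
  obtain ⟨h', rfl⟩ := hs h
  obtain ⟨t', w, hw⟩ := rep_surj h'
  obtain ⟨ψ, hψ⟩ := exists_lift I (le_max_left s t')
  obtain ⟨ψ', hψ'⟩ := exists_lift I (le_max_right s t')
  have h5 := (hh.trans hψ).sub ((hw.trans hψ').smul x)
  rw [sub_self] at h5
  obtain ⟨u, χ, hχ, e, he⟩ := h5.zero
  have h6 := ((h1.trans hφ).trans hψ).trans hχ
  have h7 : χ.f i ≫ ψ.f i ≫ φ.f i ≫ g ≫ pb x M = (PR I u).complex.d i _ ≫ e ≫ pb x M := by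
    rw [← Category.assoc (HomologicalComplex.d _ _ _), ← he]
    simp only [Preadditive.comp_sub, Preadditive.sub_comp, Linear.comp_smul, smul_pb, sub_zero,
      Category.assoc]
  rw [h7] at h6
  exact h6.bdry

lemma Conn.trans {s t : ℕ} {g : (PR I t).complex.X i ⟶ ModuleCat.of R M}
    {f : (PR I t).complex.X (i+1) ⟶ ModuleCat.of R M} 
    (h : (PR I t).complex.d (i+1) i ≫ g = x • f) (φ : (PR I s).complex ⟶ (PR I t).complex) :
    (PR I s).complex.d (i+1) i ≫ φ.f i ≫ g = x • (φ.f (i+1) ≫ f) := by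
  rw [comm_d, h, Linear.comp_smul]

lemma Conn.add {a' b'} (H : Conn I x M i a b) (H' : Conn I x M i a' b') :
    Conn I x M i (a + a') (b + b') := by
  obtain ⟨t, g, f, h1, h2, h3⟩ := H
  obtain ⟨t', g', f', h1', h2', h3'⟩ := H'
  obtain ⟨ψ, hψ⟩ := exists_lift I (le_max_left t t')
  obtain ⟨ψ', hψ'⟩ := exists_lift I (le_max_right t t')
  refine ⟨max t t', ψ.f i ≫ g + ψ'.f i ≫ g', _, ?_, (h2.trans hψ).add (h2'.trans hψ'), ?_⟩
  · have := (h1.trans hψ).add (h1'.trans hψ')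
    simpa using this
  · rw [Preadditive.comp_add, Conn.trans h3, Conn.trans h3', smul_add]

lemma Conn.smul (r : R) (H : Conn I x M i a b) : Conn I x M i (r • a) (r • b) := by
  obtain ⟨t, g, f, h1, h2, h3⟩ := H
  refine ⟨t, r • g, r • f, ?_, h2.smul r, ?_⟩
  · have := h1.smul r
    simpa using this
  · rw [Linear.comp_smul, h3, smul_comm]

lemma conn_zero : Conn I x M i 0 0 := by
  obtain ⟨t, f, hf⟩ := rep_surj (0 : Hh I (i+1) (ModuleCat.of R M))
  refine ⟨t, 0, 0, ?_, ?_, by simp⟩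
  · obtain ⟨a, ha⟩ := rep_exists (I := I) (t := t) (i := i) (f := (0 : _ ⟶ Yb x M)) (by simp)
    have := ha.smul 0
    simpa using this
  · simpa using hf.smul 0

lemma torsion_zero {h : Hh I i Y} (hx : x ∈ I) (hinj : ∀ b : Hh I i Y, x • b = 0 → b = 0) : h = 0 := by
  obtain ⟨t, f, hf⟩ := rep_surj h
  have key : ∀ (n : ℕ) (b : Hh I i Y), x ^ n • b = 0 → b = 0 := by
    intro n
    induction n with
    | zero => intro b hb; simpa using hb
    | succ n ih =>
      intro b hb
      rw [pow_succ, mul_smul] at hb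
      exact hinj _ (ih _ hb)
  exact key t h (hf.torsion (Ideal.pow_mem_pow hx t))

/-- vanishing goes up -/
lemma van_up (hx : IsSMulRegular M x) (hxI : x ∈ I) (hs : Subsingleton (Hh I i (Yb x M))) :
    Subsingleton (Hh I (i+1) (ModuleCat.of R M)) := by
  refine subsingleton_of_forall_eq 0 fun h => torsion_zero hxI fun b hb => ?_
  obtain ⟨a, ha⟩ := conn_surj b hb
  rw [Subsingleton.elim a 0] at ha
  exact conn_zero_left hx ha

lemma van_zero (hx : IsSMulRegular M x) (hxI : x ∈ I)  :
    Subsingleton (Hh I 0 (ModuleCat.of R M)) := by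
  refine subsingleton_of_forall_eq 0 fun h => torsion_zero hxI fun b hb => ?_
  obtain ⟨t, f, hf⟩ := rep_surj b
  have h2 := hf.smul x
  rw [hb] at h2
  obtain ⟨s, φ, hφ, g, hg⟩ := h2.zero
  have h0 : (PR I s).complex.d 0 ((ComplexShape.down ℕ).next 0) = 0 := 
    HomologicalComplex.shape _ _ _ (by simp)
  have h3 : φ.f 0 ≫ f = (PR I s).complex.d 0 _ ≫ g := by
    apply reg_hom hx
    rw [← Linear.comp_smul, hg, h0]; simp
  have h4 := hf.trans hφ
  rw [h3] at h4
  exact h4.bdry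

lemma van_down (hx : IsSMulRegular M x)
    (hs : ∀ h : Hh I i (ModuleCat.of R M), ∃ h', x • h' = h)
    (h1 : Subsingleton (Hh I (i+1) (ModuleCat.of R M))) : Subsingleton (Hh I i (Yb x M)) := by
  refine subsingleton_of_forall_eq 0 fun a => ?_
  obtain ⟨b, hb⟩ := conn_total hx a
  rw [Subsingleton.elim b 0] at hb
  exact conn_zero_right hs hb

/-- the isomorphism of `H^i(M/x)` with the kernel of `x` on `H^(i+1)(M)` -/
lemma exists_equiv (hx : IsSMulRegular M x) (h0 : Subsingleton (Hh I i (ModuleCat.of R M))) :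
    Nonempty (Hh I i (Yb x M) ≃ₗ[R]
      LinearMap.ker (LinearMap.lsmul R (Hh I (i+1) (ModuleCat.of R M)) x)) := by
  have hs : ∀ h : Hh I i (ModuleCat.of R M), ∃ h', x • h' = h := fun h => ⟨0, Subsingleton.elim _ _⟩
  have uniq : ∀ a b b', Conn I x M i a b → Conn I x M i a b' → b = b' := by
    intro a b b' h h'
    have := h.add (h'.smul (-1))
    have e : a + (-1 : R) • a = 0 := by simp
    rw [e] at this
    have := conn_zero_left hx this
    rw [neg_one_smul, ← sub_eq_add_neg] at this
    exact sub_eq_zero.1 this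
  have uniq' : ∀ a a' b, Conn I x M i a b → Conn I x M i a' b → a = a' := by
    intro a a' b h h'
    have := h.add (h'.smul (-1))
    have e : b + (-1 : R) • b = 0 := by simp
    rw [e] at this
    have := conn_zero_right hs this
    rw [neg_one_smul, ← sub_eq_add_neg] at this
    exact sub_eq_zero.1 this
  choose δ hδ using conn_total (I := I) (i := i) hx
  let δl : Hh I i (Yb x M) →ₗ[R] LinearMap.ker (LinearMap.lsmul R (Hh I (i+1) (ModuleCat.of R M)) x) :=
    { toFun := fun a => ⟨δ a, (hδ a).ker⟩
      map_add' := fun a a' => Subtype.ext (uniq _ _ _ (hδ _) ((hδ a).add (hδ a')))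
      map_smul' := fun r a => Subtype.ext (uniq _ _ _ (hδ _) ((hδ a).smul r)) }
  refine ⟨LinearEquiv.ofBijective δl ⟨?_, ?_⟩⟩
  · intro a a' h
    have h' : δ a = δ a' := congrArg Subtype.val h
    exact uniq' _ _ _ (hδ a) (h' ▸ hδ a')
  · rintro ⟨b, hb⟩
    obtain ⟨a, ha⟩ := conn_surj b hb
    exact ⟨a, Subtype.ext (uniq _ _ _ (hδ a) ha)⟩

end ses

section dual
variable {E : Type} [AddCommGroup E] [Module R E]

/-- nonzero functional -/
lemma exists_ne [IsLocalRing R] (f : IsLocalRing.ResidueField R →ₗ[R] E)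
    (hinj : Module.Injective R E) (hf : Function.Injective f)
    {Q : Type} [AddCommGroup Q] [Module R Q] (q : Q) (hq : q ≠ 0) : ∃ g : Q →ₗ[R] E, g q ≠ 0 := by
  have hle : LinearMap.ker (LinearMap.toSpanSingleton R Q q) ≤ IsLocalRing.maximalIdeal R := by
    apply IsLocalRing.le_maximalIdeal
    intro h
    have : (1 : R) ∈ LinearMap.ker (LinearMap.toSpanSingleton R Q q) := by rw [h]; trivial
    simp at this
    exact hq this
  let p : (R ⧸ LinearMap.ker (LinearMap.toSpanSingleton R Q q)) →ₗ[R] E :=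
    f ∘ₗ Submodule.mapQ _ (IsLocalRing.maximalIdeal R) LinearMap.id hle
  let e := (LinearMap.ker (LinearMap.toSpanSingleton R Q q)).liftQ
    (LinearMap.toSpanSingleton R Q q) le_rfl
  have he : Function.Injective e := by
    rw [← LinearMap.ker_eq_bot]
    exact Submodule.ker_liftQ_eq_bot' _ _ rfl
  obtain ⟨g, hg⟩ := hinj.out e he p
  refine ⟨g, ?_⟩
  have h1 := hg (Submodule.Quotient.mk 1)
  have h2 : e (Submodule.Quotient.mk 1) = q := one_smul R q
  rw [h2] at h1
  rw [h1]
  have h3 : p (Submodule.Quotient.mk 1) = f (IsLocalRing.residue R 1) := rfl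
  rw [h3, map_one]
  intro h
  exact one_ne_zero (hf (h.trans (map_zero f).symm))

lemma smul_surj [IsLocalRing R] (f : IsLocalRing.ResidueField R →ₗ[R] E)
    (hinj : Module.Injective R E) (hf : Function.Injective f)
    {H : Type} [AddCommGroup H] [Module R H] {x : R} (hx : IsSMulRegular (H →ₗ[R] E) x) (h : H) :
    ∃ h', x • h' = h := by
  by_contra hne
  let N := LinearMap.range (LinearMap.lsmul R H x)
  have hq : N.mkQ h ≠ 0 := by
    intro h0
    rw [Submodule.mkQ_apply, Submodule.Quotient.mk_eq_zero] at h0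
    exact hne h0
  obtain ⟨g, hg⟩ := exists_ne f hinj hf _ hq
  apply hg
  have : g ∘ₗ N.mkQ = 0 := by
    apply hx
    refine LinearMap.ext fun k => ?_
    change x • g (N.mkQ k) = x • (0 : E)
    rw [smul_zero, ← map_smul, ← map_smul]
    have : N.mkQ (x • k) = 0 := by
      rw [Submodule.mkQ_apply, Submodule.Quotient.mk_eq_zero]
      exact ⟨k, rfl⟩
    rw [this, map_zero]
  exact congrArg (fun k => k h) this

open scoped Pointwise in
lemma dual_equiv (hinj : Module.Injective R E)
    {H : Type} [AddCommGroup H] [Module R H] {x : R} (hs : ∀ h : H, ∃ h', x • h' = h) :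
    Nonempty (QuotSMulTop x (H →ₗ[R] E) ≃ₗ[R] (LinearMap.ker (LinearMap.lsmul R H x) →ₗ[R] E)) := by
  let K := LinearMap.ker (LinearMap.lsmul R H x)
  let ρ : (H →ₗ[R] E) →ₗ[R] (K →ₗ[R] E) := LinearMap.lcomp R E K.subtype
  have hρ : Function.Surjective ρ := by
    intro g
    obtain ⟨g', hg'⟩ := hinj.out K.subtype K.injective_subtype g
    exact ⟨g', LinearMap.ext hg'⟩
  have hk : LinearMap.ker ρ = (x • ⊤ : Submodule R (H →ₗ[R] E)) := by
    ext g
    rw [LinearMap.mem_ker, Submodule.mem_smul_pointwise_iff_exists]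
    constructor
    · intro hg
      have hsurj : Function.Surjective (LinearMap.lsmul R H x) := hs
      have hle : LinearMap.ker (LinearMap.lsmul R H x) ≤ LinearMap.ker g := by
        intro k hk
        exact congrArg (fun u => u ⟨k, hk⟩) hg
      let e := (LinearMap.lsmul R H x).quotKerEquivOfSurjective hsurj
      refine ⟨(Submodule.liftQ _ g hle) ∘ₗ e.symm.toLinearMap, trivial, ?_⟩
      refine LinearMap.ext fun k => ?_
      have : e.symm (x • k) = Submodule.Quotient.mk k := by
        rw [LinearEquiv.symm_apply_eq]
        rfl
      change x • ((Submodule.liftQ _ g hle) (e.symm k)) = g k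
      rw [← map_smul, ← map_smul, this]
      simp
    · rintro ⟨g', -, rfl⟩
      refine LinearMap.ext fun k => ?_
      have hk : x • (k : H) = 0 := k.2
      change x • g' k = 0
      rw [← map_smul, hk, map_zero]
  exact ⟨(Submodule.quotEquivOfEq _ _ hk.symm).trans (ρ.quotKerEquivOfSurjective hρ)⟩

end dual

lemma nontriv_congr {I : Ideal R} {i : ℕ} {M N : Type} [AddCommGroup M] [Module R M]
    [AddCommGroup N] [Module R N] (e : M ≃ₗ[R] N) :
    Nontrivial (Hh I i (ModuleCat.of R M)) ↔ Nontrivial (Hh I i (ModuleCat.of R N)) :=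
  ((localCohomology I i).mapIso e.toModuleIso).toLinearEquiv.toEquiv.nontrivial_congr

/-- Concentrated in degree `c`. -/
def Conc (I : Ideal R) (M : Type) [AddCommGroup M] [Module R M] (c : ℕ) : Prop :=
  ∀ i : ℕ, Nontrivial ((localCohomology I i).obj (ModuleCat.of R M)) ↔ i = c

lemma conc_congr {I : Ideal R} {c : ℕ} {M N : Type} [AddCommGroup M] [Module R M]
    [AddCommGroup N] [Module R N] (e : M ≃ₗ[R] N) : Conc I M c ↔ Conc I N c :=
  forall_congr' fun i => by rw [nontriv_congr e]

def nilE (M : Type) [AddCommGroup M] [Module R M] :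
    (M ⧸ (Ideal.ofList ([] : List R) • ⊤ : Submodule R M)) ≃ₗ[R] M :=
  Submodule.quotEquivOfEqBot _ (by simp)

lemma Conc.sub {I : Ideal R} {c : ℕ} {M : Type} [AddCommGroup M] [Module R M] (h : Conc I M c)
    {i : ℕ} (hi : i ≠ c) : Subsingleton (Hh I i (ModuleCat.of R M)) := by
  rw [← not_nontrivial_iff_subsingleton]
  exact fun h' => hi ((h i).1 h')

lemma backward {I : Ideal R} (xs : List R) : ∀ (M : Type) [AddCommGroup M] [Module R M] (d : ℕ)
    (_ : ∀ x ∈ xs, x ∈ I) (_ : RingTheory.Sequence.IsWeaklyRegular M xs)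
    (_ : ∀ i, i ≠ d → 
      Subsingleton (Hh I i (ModuleCat.of R (M ⧸ (Ideal.ofList xs • ⊤ : Submodule R M))))),
    ∃ d, ∀ i, i ≠ d → Subsingleton (Hh I i (ModuleCat.of R M)) := by
  induction xs with
  | nil =>
    intro M _ _ d _ _ h
    refine ⟨d, fun i hi => ?_⟩
    have := h i hi
    rw [← not_nontrivial_iff_subsingleton] at this ⊢
    rwa [← nontriv_congr (nilE M)]
  | cons x xs ih =>
    intro M _ _ d hI hreg h
    rw [RingTheory.Sequence.isWeaklyRegular_cons_iff] at hreg
    obtain ⟨d', hd'⟩ := ih (QuotSMulTop x M) d (fun y hy => hI y (List.mem_cons_of_mem _ hy)) hreg.2 (by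
      intro i hi
      have := h i hi
      rw [← not_nontrivial_iff_subsingleton] at this ⊢
      rwa [← nontriv_congr (Submodule.quotOfListConsSMulTopEquivQuotSMulTopInner M x xs)])
    refine ⟨d' + 1, fun i hi => ?_⟩
    cases i with
    | zero => exact van_zero hreg.1 (hI x List.mem_cons_self)
    | succ i => exact van_up hreg.1 (hI x List.mem_cons_self) (hd' i (by omega))

lemma forward [IsLocalRing R] {I : Ideal R} {E : Type} [AddCommGroup E] [Module R E]
    (f : IsLocalRing.ResidueField R →ₗ[R] E)
    (hinj : Module.Injective R E) (hf : Function.Injective f) (xs : List R) :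
    ∀ (M : Type) [AddCommGroup M] [Module R M] (c : ℕ)
    (_ : ∀ x ∈ xs, x ∈ I) (_ : RingTheory.Sequence.IsWeaklyRegular M xs)
    (_ : RingTheory.Sequence.IsWeaklyRegular (Hh I c (ModuleCat.of R M) →ₗ[R] E) xs)
    (_ : Conc I M c),
    ∃ d, Conc I (M ⧸ (Ideal.ofList xs • ⊤ : Submodule R M)) d := by
  induction xs with
  | nil =>
    intro M _ _ c _ _ _ h
    exact ⟨c, (conc_congr (nilE M)).2 h⟩
  | cons x xs ih =>
    intro M _ _ c hI hreg hD h
    have hxI := hI x List.mem_cons_self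
    rw [RingTheory.Sequence.isWeaklyRegular_cons_iff] at hreg hD
    cases c with
    | zero =>
      exact absurd (van_zero hreg.1 hxI) (not_subsingleton_iff_nontrivial.2 ((h 0).2 rfl))
    | succ c =>
      have hs := smul_surj f hinj hf hD.1
      obtain ⟨e⟩ := exists_equiv hreg.1 (h.sub (i := c) (by omega))
      obtain ⟨e'⟩ := dual_equiv hinj hs
      have hD2 := (LinearEquiv.isWeaklyRegular_congr e' xs).1 hD.2
      have hD3 := (LinearEquiv.isWeaklyRegular_congr (LinearEquiv.congrLeft E R e) xs).2 hD2
      have hC : Conc I (QuotSMulTop x M) c := by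
        intro i
        constructor
        · intro hn
          by_contra hi
          refine not_subsingleton_iff_nontrivial.2 hn ?_
          refine van_down hreg.1 ?_ (h.sub (by omega))
          by_cases hic : i = c + 1
          · subst hic
            exact hs
          · have := h.sub hic
            exact fun h => ⟨0, Subsingleton.elim _ _⟩
        · rintro rfl
          by_contra hn
          rw [not_nontrivial_iff_subsingleton] at hn
          exact not_subsingleton_iff_nontrivial.2 ((h (i+1)).2 rfl) (van_up hreg.1 hxI hn)
      obtain ⟨d, hd⟩ := ih (QuotSMulTop x M) c (fun y hy => hI y (List.mem_cons_of_mem _ hy))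
        hreg.2 hD3 hC
      exact ⟨d, (conc_congr (Submodule.quotOfListConsSMulTopEquivQuotSMulTopInner M x xs)).2 hd⟩

end LC
end

/-- Corollary 2.11(ii): for `x₁,…,xₙ ∈ 𝔞` a regular sequence on both `M` and `D_R(H^c_𝔞(M))`,
`M` is relative Cohen-Macaulay w.r.t. `𝔞` iff `M/(x₁,…,xₙ)M` is. -/
theorem stmt2 {R : Type} [CommRing R] [IsNoetherianRing R] [IsLocalRing R]
    (𝔞 : Ideal R) (h𝔞 : 𝔞 ≠ ⊤)
    (M : Type) [AddCommGroup M] [Module R M] [Module.Finite R M]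
    (c : ℕ) (hc : c = cohDim 𝔞 M) (hc0 : 0 < c)
    (E : Type) [AddCommGroup E] [Module R E]
    (f : IsLocalRing.ResidueField R →ₗ[R] E) (hE : IsInjectiveHull R f)
    (xs : List R) (hxs : ∀ x ∈ xs, x ∈ 𝔞)
    (hregM : RingTheory.Sequence.IsRegular M xs)
    (hregD : RingTheory.Sequence.IsRegular
      (((localCohomology 𝔞 c).obj (ModuleCat.of R M)) →ₗ[R] E) xs) :
    IsRelCM 𝔞 M ↔ IsRelCM 𝔞 (M ⧸ (Ideal.ofList xs • ⊤ : Submodule R M)) := by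
  have hn : Nontrivial ((localCohomology 𝔞 c).obj (ModuleCat.of R M)) := by
    have hS : c = sSup {i : ℕ | Nontrivial ((localCohomology 𝔞 i).obj (ModuleCat.of R M))} := hc
    have hbdd : BddAbove {i : ℕ | Nontrivial ((localCohomology 𝔞 i).obj (ModuleCat.of R M))} := by
      by_contra hb
      rw [Nat.sSup_of_not_bddAbove hb] at hS
      omega
    have hne : {i : ℕ | Nontrivial ((localCohomology 𝔞 i).obj (ModuleCat.of R M))}.Nonempty := by
      rw [Set.nonempty_iff_ne_empty]
      intro he
      rw [he, csSup_empty, Nat.bot_eq_zero] at hS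
      omega
    have hmem := Nat.sSup_mem hne hbdd
    rw [← hS] at hmem
    exact hmem
  constructor
  · rintro ⟨c', h⟩
    obtain rfl := (h c).1 hn
    exact LC.forward f hE.injective hE.inj xs M _ hxs hregM.toIsWeaklyRegular
      hregD.toIsWeaklyRegular h
  · rintro ⟨d, h⟩
    obtain ⟨d', h'⟩ := LC.backward xs M d hxs hregM.toIsWeaklyRegular
      (fun i hi => LC.Conc.sub h hi)
    have key : ∀ i, Nontrivial ((localCohomology 𝔞 i).obj (ModuleCat.of R M)) → i = d' := by
      intro i hi
      by_contra hne
      exact not_nontrivial_iff_subsingleton.2 (h' i hne) hi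
    refine ⟨c, fun i => ⟨fun hi => (key i hi).trans (key c hn).symm, ?_⟩⟩
    rintro rfl
    exact hn
end

section
/- Let R be a Noetherian ring, 𝔞 ⊊ R a proper ideal, M a finite R-module with c = cd(𝔞,M), and let {M_i}_{i=0}^c be an increasing filtration of submodules of M with M_c = M and cd(𝔞,M_0) = 0. Then the following are equivalent: (i) Ass_R(M_i/M_{i−1}) = {𝔭 ∈ Ass_R(M) : cd(𝔞, R/𝔭) = i} for all 1 ≤ i ≤ c; (ii) {M_i}_{i=0}^c is the cd-filtration of M. -/
open CategoryTheory

section helpers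
open CategoryTheory Limits


/-- the transition map `R/I^s → R/I^t` -/
abbrev resM {R : Type} [CommRing R] (I : Ideal R) {s t : ℕ} (h : t ≤ s) : ModuleCat.of R (R ⧸ I ^ s) ⟶ ModuleCat.of R (R ⧸ I ^ t) :=
  ModuleCat.ofHom (Submodule.mapQ (I ^ s) (I ^ t) LinearMap.id (Ideal.pow_le_pow_right h))

/-- vanishing predicate -/
def VV {R : Type} [CommRing R] (I : Ideal R) (i : ℕ) (M : Type) [AddCommGroup M] [Module R M] : Prop :=
  ∀ (t : ℕ) (e : Abelian.Ext (ModuleCat.of R (R ⧸ I ^ t)) (ModuleCat.of R M) i), ∃ (s : ℕ) (h : t ≤ s),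
    (Abelian.Ext.mk₀ (resM I h)).comp e (zero_add i) = 0

section bridge
variable {R : Type} [CommRing R]

lemma subsing_iff (I : Ideal R) (i : ℕ) (M : ModuleCat.{0} R) :
    Subsingleton ((localCohomology I i).obj M) ↔
    ∀ (t : ℕ) (e : ((Ext R (ModuleCat.{0} R) i).obj (Opposite.op (ModuleCat.of R (R ⧸ I ^ t)))).obj M),
      ∃ (s : ℕ) (h : t ≤ s), (((Ext R (ModuleCat.{0} R) i).map (ModuleCat.ofHom (Submodule.mapQ (I ^ s) (I ^ t) LinearMap.id
      (Ideal.pow_le_pow_right h))).op).app M).hom e = 0 := by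
  let D := localCohomology.diagram (localCohomology.idealPowersDiagram I) i
  have hc : IsColimit (((evaluation _ _).obj M).mapCocone (colimit.cocone D)) :=
    isColimitOfPreserves _ (colimit.isColimit D)
  constructor
  · intro hs t e
    obtain ⟨k, f, g, h⟩ := (Concrete.isColimit_rep_eq_iff_exists _ hc (i := Opposite.op (Opposite.op t)) (j := Opposite.op (Opposite.op t)) e 0).mp
      (@Subsingleton.elim _ hs _ _)
    refine ⟨k.unop.unop, f.unop.unop.down.down, ?_⟩
    rw [map_zero] at h
    exact h
  · intro H
    refine subsingleton_of_forall_eq 0 fun y => ?_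
    obtain ⟨j, e, he⟩ := Concrete.isColimit_exists_rep _ hc y
    obtain ⟨s, h, hs⟩ := H j.unop.unop e
    rw [← he]
    refine Eq.trans ?_ (map_zero (((((evaluation _ _).obj M).mapCocone (colimit.cocone D)).ι.app (Opposite.op (Opposite.op s))).hom))
    refine (Concrete.isColimit_rep_eq_iff_exists _ hc e 0).mpr ⟨Opposite.op (Opposite.op s), (homOfLE h).op.op, 𝟙 _, ?_⟩
    rw [map_zero]
    exact hs

end bridge


section rep
variable {R : Type} [CommRing R]

abbrev cK {X : ModuleCat.{0} R} (P : ProjectiveResolution X) (Y : ModuleCat.{0} R) :=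
  ((((linearYoneda R (ModuleCat.{0} R)).obj Y).rightOp.mapHomologicalComplex (ComplexShape.down ℕ)).obj P.complex)

def RepBy {X : ModuleCat.{0} R} (P : ProjectiveResolution X) (Y : ModuleCat.{0} R) (n : ℕ)
   (f : P.complex.X n ⟶ Y) (e : ((Ext R (ModuleCat.{0} R) n).obj (Opposite.op X)).obj Y) : Prop :=
  ∃ z : ((cK P Y).opcycles n).unop, ((cK P Y).pOpcycles n).unop.hom z = f ∧
    (((cK P Y).homologyι n) ).unop.hom z =
      (P.isoLeftDerivedObj ((linearYoneda R (ModuleCat.{0} R)).obj Y).rightOp n).inv.unop.hom e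

lemma rep_exists {X : ModuleCat.{0} R} (P : ProjectiveResolution X) (Y : ModuleCat.{0} R) (n : ℕ)
   (e : ((Ext R (ModuleCat.{0} R) n).obj (Opposite.op X)).obj Y) :
   ∃ f, P.complex.d (n+1) n ≫ f = 0 ∧ RepBy P Y n f e := by
  have : Epi ((cK P Y).homologyι n).unop := inferInstance
  obtain ⟨z, hz⟩ := (ModuleCat.epi_iff_surjective _).mp this ((P.isoLeftDerivedObj ((linearYoneda R (ModuleCat.{0} R)).obj Y).rightOp n).inv.unop.hom e)
  refine ⟨((cK P Y).pOpcycles n).unop.hom z, ?_, z, rfl, hz⟩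
  have h := congrArg Quiver.Hom.unop ((cK P Y).d_pOpcycles (n+1) n)
  exact congrArg (fun u => u.hom z) h

lemma rep_of {X : ModuleCat.{0} R} (P : ProjectiveResolution X) (Y : ModuleCat.{0} R) (n : ℕ)
   (f : P.complex.X n ⟶ Y) (hf : P.complex.d (n+1) n ≫ f = 0) : ∃ e, RepBy P Y n f e := by
  have hex := (ShortComplex.mk _ _ ((cK P Y).d_pOpcycles (n+1) n)).exact_of_g_is_cokernel ((cK P Y).opcyclesIsCokernel (n+1) n (by simp))
  have hex := (ShortComplex.moduleCat_exact_iff _).mp hex.unop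
  obtain ⟨z, hz⟩ := hex f hf
  refine ⟨(P.isoLeftDerivedObj ((linearYoneda R (ModuleCat.{0} R)).obj Y).rightOp n).hom.unop.hom (((cK P Y).homologyι n).unop.hom z), z, hz, ?_⟩
  have h := congrArg Quiver.Hom.unop (P.isoLeftDerivedObj ((linearYoneda R (ModuleCat.{0} R)).obj Y).rightOp n).inv_hom_id
  exact (congrArg (fun u => u.hom (((cK P Y).homologyι n).unop.hom z)) h).symm

lemma rep_zero_iff {X : ModuleCat.{0} R} (P : ProjectiveResolution X) (Y : ModuleCat.{0} R) (n : ℕ)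
   (f : P.complex.X (n+1) ⟶ Y) (e) (h : RepBy P Y (n+1) f e) :
   e = 0 ↔ ∃ g, P.complex.d (n+1) n ≫ g = f := by
  obtain ⟨z, rfl, hz⟩ := h
  have hex := (ShortComplex.mk _ _ ((cK P Y).homologyι_comp_fromOpcycles (n+1) n)).exact_of_f_is_kernel ((cK P Y).homologyIsKernel (n+1) n (by simp))
  have hex := (ShortComplex.moduleCat_exact_iff _).mp hex.unop
  have hcomp := congrArg Quiver.Hom.unop ((cK P Y).homologyι_comp_fromOpcycles (n+1) n)
  have hd := congrArg Quiver.Hom.unop ((cK P Y).p_fromOpcycles (n+1) n)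
  have hinj : Function.Injective ((cK P Y).pOpcycles (n+1)).unop.hom :=
    (ModuleCat.mono_iff_injective _).mp inferInstance
  have h1 : e = 0 ↔ (P.isoLeftDerivedObj ((linearYoneda R (ModuleCat.{0} R)).obj Y).rightOp (n+1)).inv.unop.hom e = 0 := by
    constructor
    · rintro rfl; exact map_zero _
    · intro h
      have h' := congrArg Quiver.Hom.unop (P.isoLeftDerivedObj ((linearYoneda R (ModuleCat.{0} R)).obj Y).rightOp (n+1)).hom_inv_id
      have h2 := (congrArg (fun u => u.hom e) h')
      refine h2.symm.trans ?_
      refine (congrArg (P.isoLeftDerivedObj ((linearYoneda R (ModuleCat.{0} R)).obj Y).rightOp (n+1)).hom.unop.hom h).trans (map_zero _)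
  rw [h1, ← hz]
  constructor
  · intro h0
    obtain ⟨g, hg⟩ := hex z h0
    refine ⟨g, ?_⟩
    rw [← hg]
    exact (congrArg (fun u => u.hom g) hd).symm
  · rintro ⟨g, hg⟩
    have : z = ((cK P Y).fromOpcycles (n+1) n).unop.hom g := by
      apply hinj
      rw [← hg]
      exact (congrArg (fun u => u.hom g) hd).symm
    rw [this]
    exact (congrArg (fun u => u.hom g) hcomp)

lemma rep_map {X X' : ModuleCat.{0} R} (P : ProjectiveResolution X) (P' : ProjectiveResolution X') (g : X' ⟶ X)
   (φ : ProjectiveResolution.Hom P' P g) (Y : ModuleCat.{0} R) (n : ℕ)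
   (f : P.complex.X n ⟶ Y) (e) (h : RepBy P Y n f e) :
   RepBy P' Y n (φ.hom.f n ≫ f) (((Ext R (ModuleCat.{0} R) n).map g.op).app Y e) := by
  obtain ⟨z, rfl, hz⟩ := h
  let F := ((linearYoneda R (ModuleCat.{0} R)).obj Y).rightOp
  let ψ : cK P' Y ⟶ cK P Y := (F.mapHomologicalComplex (ComplexShape.down ℕ)).map φ.hom
  refine ⟨(HomologicalComplex.opcyclesMap ψ n).unop.hom z, ?_, ?_⟩
  · have := congrArg Quiver.Hom.unop (HomologicalComplex.p_opcyclesMap ψ n)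
    exact (congrArg (fun u => u.hom z) this)
  · have h1 := congrArg Quiver.Hom.unop (HomologicalComplex.homologyι_naturality ψ n)
    have h1' := (congrArg (fun u => u.hom z) h1)
    have h2 := congrArg Quiver.Hom.unop (ProjectiveResolution.isoLeftDerivedObj_inv_naturality g P' P φ.hom
      (by simpa using φ.hom_f_zero_comp_π_f_zero) F n)
    have h2' := (congrArg (fun u => u.hom e) h2)
    refine h1'.symm.trans (Eq.trans ?_ h2'.symm)
    exact congrArg (HomologicalComplex.homologyMap ψ n).unop.hom hz

lemma VV_iff (I : Ideal R) (i : ℕ) (M : Type) [AddCommGroup M] [Module R M] :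
    VV I (i+1) M ↔ Subsingleton ((localCohomology I (i+1)).obj (ModuleCat.of R M)) := by
  rw [subsing_iff]
  let P (t : ℕ) : ProjectiveResolution (ModuleCat.of R (R ⧸ I ^ t)) := projectiveResolution _
  have key (t s) (g : (ModuleCat.of R (R ⧸ I ^ s)) ⟶ (ModuleCat.of R (R ⧸ I ^ t))) (f) 
      (hf : (P t).complex.d (i+1+1) (i+1) ≫ f = 0) (e) (he : RepBy (P t) (ModuleCat.of R M) (i+1) f e) :
      ((Ext R (ModuleCat.{0} R) (i+1)).map g.op).app (ModuleCat.of R M) e = 0 ↔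
       (Abelian.Ext.mk₀ g).comp ((P t).extMk f _ rfl hf) (zero_add _) = 0 := by
    let φ : ProjectiveResolution.Hom (P s) (P t) g := 
      ⟨ProjectiveResolution.lift g _ _, by simpa using ProjectiveResolution.lift_commutes_zero g (P s) (P t)⟩ 
    rw [ProjectiveResolution.mk₀_comp_extMk f _ rfl hf φ,
      ProjectiveResolution.extMk_eq_zero_iff _ _ _ _ _ i rfl]
    exact rep_zero_iff _ _ _ _ _ (rep_map _ _ _ _ _ _ _ _ he)
  constructor
  · intro H t e
    obtain ⟨f, hf, hr⟩ := rep_exists (P t) _ _ e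
    obtain ⟨s, h, hs⟩ := H t ((P t).extMk f _ rfl hf)
    exact ⟨s, h, (key _ _ _ _ _ _ hr).mpr hs⟩
  · intro H t e
    obtain ⟨f, hf, rfl⟩ := (P t).extMk_surjective e _ rfl
    obtain ⟨e, he⟩ := rep_of (P t) _ _ f hf
    obtain ⟨s, h, hs⟩ := H t e
    exact ⟨s, h, (key _ _ _ _ _ _ he).mp hs⟩
end rep


section les
variable {R : Type} [CommRing R]

lemma resM_comp (I : Ideal R) {s t u : ℕ} (h : t ≤ s) (h' : u ≤ t) :
    resM I h ≫ resM I h' = resM I (h'.trans h) := by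
  ext
  rfl

variable {A B C : Type} [AddCommGroup A] [Module R A] [AddCommGroup B] [Module R B] [AddCommGroup C] [Module R C]
  {f : A →ₗ[R] B} {g : B →ₗ[R] C}

lemma ses (hf : Function.Injective f) (hg : Function.Surjective g) (h : Function.Exact f g) :
   (ModuleCat.shortComplexOfCompEqZero f g h.linearMap_comp_eq_zero).ShortExact :=
  ModuleCat.shortComplex_shortExact _ h hf hg

lemma VV_ext (I : Ideal R) (i : ℕ) (hf : Function.Injective f) (hg : Function.Surjective g) (h : Function.Exact f g)
   (hA : VV I i A) (hC : VV I i C) : VV I i B := by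
  intro t e
  obtain ⟨s, hs, h1⟩ := hC t (e.comp (Abelian.Ext.mk₀ (ModuleCat.ofHom g)) (add_zero i))
  rw [← Abelian.Ext.comp_assoc_of_third_deg_zero] at h1
  obtain ⟨a, ha⟩ := Abelian.Ext.covariant_sequence_exact₂ _ (ses hf hg h) _ h1
  obtain ⟨u, hu, h2⟩ := hA s a
  refine ⟨u, hs.trans hu, ?_⟩
  rw [← resM_comp I hu hs, ← Abelian.Ext.mk₀_comp_mk₀_assoc, ← ha, ← Abelian.Ext.comp_assoc_of_third_deg_zero]
  erw [h2]
  simp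

lemma VV_right (I : Ideal R) (i : ℕ) (hf : Function.Injective f) (hg : Function.Surjective g) (h : Function.Exact f g)
   (hB : VV I i B) (hA : VV I (i+1) A) : VV I i C := by
  intro t e
  obtain ⟨s, hs, h1⟩ := hA t (e.comp (ses hf hg h).extClass rfl)
  have h1' : ((Abelian.Ext.mk₀ (resM I hs)).comp e (zero_add i)).comp (ses hf hg h).extClass rfl = 0 := by
    rw [Abelian.Ext.comp_assoc (h₂₃ := rfl)]
    · exact h1
    · lia
  obtain ⟨b, hb⟩ := Abelian.Ext.covariant_sequence_exact₃ _ (ses hf hg h) _ rfl h1'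
  obtain ⟨u, hu, h2⟩ := hB s b
  refine ⟨u, hs.trans hu, ?_⟩
  rw [← resM_comp I hu hs, ← Abelian.Ext.mk₀_comp_mk₀_assoc, ← hb, ← Abelian.Ext.comp_assoc_of_third_deg_zero]
  erw [h2]
  simp

lemma VV_left (I : Ideal R) (i : ℕ) (hf : Function.Injective f) (hg : Function.Surjective g) (h : Function.Exact f g)
   (hC : VV I i C) (hB : VV I (i+1) B) : VV I (i+1) A := by
  intro t e
  obtain ⟨s, hs, h1⟩ := hB t (e.comp (Abelian.Ext.mk₀ (ModuleCat.ofHom f)) (add_zero _))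
  rw [← Abelian.Ext.comp_assoc_of_third_deg_zero] at h1
  obtain ⟨c, hc⟩ := Abelian.Ext.covariant_sequence_exact₁ _ (ses hf hg h) _ h1 rfl
  obtain ⟨u, hu, h2⟩ := hC s c
  refine ⟨u, hs.trans hu, ?_⟩
  rw [← resM_comp I hu hs, ← Abelian.Ext.mk₀_comp_mk₀_assoc, ← hc, ← Abelian.Ext.comp_assoc (h₁₂ := zero_add _) (h₂₃ := rfl) (h := by lia)]
  erw [h2]
  simp

lemma VV_injective (I : Ideal R) (i : ℕ) [Module.Injective R A] : VV I (i+1) A := by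
  intro t e
  have := Module.injective_object_of_injective_module R A
  exact ⟨t, le_rfl, by rw [Abelian.Ext.eq_zero_of_injective e]; simp⟩

lemma VV_bijective (I : Ideal R) (i : ℕ) (x : R) (hx : x ∈ I) (hb : Function.Bijective (fun a : A => x • a)) :
    VV I i A := by
  intro t e
  refine ⟨t, le_rfl, ?_⟩
  have h0 : x ^ t • e = 0 := by
    rw [← Abelian.Ext.mk₀_id_comp e, ← Abelian.Ext.smul_comp, ← Abelian.Ext.mk₀_smul]
    have : x ^ t • 𝟙 (ModuleCat.of R (R ⧸ I ^ t)) = 0 := by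
      ext
      change Ideal.Quotient.mk (I^t) (x ^ t * 1) = 0
      rw [Ideal.Quotient.eq_zero_iff_mem, mul_one]
      exact Ideal.pow_mem_pow hx t
    rw [this]; simp
  rw [Abelian.Ext.smul_eq_comp_mk₀] at h0
  have hbt : Function.Bijective (fun a : A => x ^ t • a) := by
    clear h0 e
    induction t with
    | zero => simp only [pow_zero, one_smul]; exact Function.bijective_id
    | succ n ih =>
      have := ih.comp hb
      convert this using 1
      ext a; simp [pow_succ, mul_smul]
  have : IsIso (x ^ t • 𝟙 (ModuleCat.of R A)) := by
    rw [ConcreteCategory.isIso_iff_bijective]; exact hbt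
  have he : e = 0 := by
    have h2 := congrArg (fun u => Abelian.Ext.comp u (Abelian.Ext.mk₀ (inv (x ^ t • 𝟙 (ModuleCat.of R A)))) (add_zero _)) h0
    rw [Abelian.Ext.comp_assoc_of_third_deg_zero, Abelian.Ext.mk₀_comp_mk₀, IsIso.hom_inv_id] at h2
    simpa using h2
  rw [he]; simp

lemma VV_equiv (I : Ideal R) (i : ℕ) (e : A ≃ₗ[R] B) (h : VV I i A) : VV I i B := by
  intro t a
  obtain ⟨s, hs, h1⟩ := h t (a.comp (Abelian.Ext.mk₀ (ModuleCat.ofHom e.symm.toLinearMap)) (add_zero _))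
  refine ⟨s, hs, ?_⟩
  have h2 := congrArg (fun u => Abelian.Ext.comp u (Abelian.Ext.mk₀ (ModuleCat.ofHom e.toLinearMap)) (add_zero _)) h1
  have h3 : ModuleCat.ofHom e.symm.toLinearMap ≫ ModuleCat.ofHom e.toLinearMap = 𝟙 _ := by
    ext x; simp
  rw [Abelian.Ext.comp_assoc_of_third_deg_zero, Abelian.Ext.comp_assoc_of_third_deg_zero, Abelian.Ext.mk₀_comp_mk₀, h3] at h2
  simpa using h2

lemma VV_subsingleton (I : Ideal R) (i : ℕ) [Subsingleton A] : VV I i A := by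
  intro t e
  refine ⟨t, le_rfl, ?_⟩
  have h3 : 𝟙 (ModuleCat.of R A) = 0 := by
    ext x; exact Subsingleton.elim _ _
  rw [← Abelian.Ext.comp_mk₀_id e, h3]; simp

def TorsBy (I : Ideal R) (c : C) : Prop := ∃ t : ℕ, ∀ y ∈ I ^ t, y • c = 0

lemma VV_one_iff (I : Ideal R) (hf : Function.Injective f) (hg : Function.Surjective g) (h : Function.Exact f g)
   [Module.Injective R B] : VV I 1 A ↔ ∀ c, TorsBy I c → ∃ b, TorsBy I b ∧ g b = c := by
  have := Module.injective_object_of_injective_module R B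
  constructor
  · rintro H c ⟨t, ht⟩
    let u : ModuleCat.of R (R ⧸ I ^ t) ⟶ ModuleCat.of R C :=
      ModuleCat.ofHom (Submodule.liftQ (I ^ t) (LinearMap.toSpanSingleton R C c) (fun y hy => ht y hy))
    obtain ⟨s, hs, h1⟩ := H t ((Abelian.Ext.mk₀ u).comp (ses hf hg h).extClass rfl)
    have h1' : ((Abelian.Ext.mk₀ (resM I hs)).comp (Abelian.Ext.mk₀ u) (zero_add 0)).comp (ses hf hg h).extClass rfl = 0 := by
      rw [Abelian.Ext.comp_assoc (h₂₃ := rfl)]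
      · exact h1
      · lia
    obtain ⟨b, hb⟩ := Abelian.Ext.covariant_sequence_exact₃ _ (ses hf hg h) _ rfl h1'
    obtain ⟨v, rfl⟩ := Abelian.Ext.mk₀_bijective _ _ |>.surjective b
    rw [Abelian.Ext.mk₀_comp_mk₀, Abelian.Ext.mk₀_comp_mk₀] at hb
    have hb := (Abelian.Ext.mk₀_bijective _ _).injective hb
    refine ⟨v.hom (Submodule.Quotient.mk 1), ⟨s, fun y hy => ?_⟩, ?_⟩
    · rw [← map_smul, ← Submodule.Quotient.mk_smul, (Submodule.Quotient.mk_eq_zero _).mpr (by simpa using hy), map_zero]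
    · have := congrArg (fun w => w.hom (Submodule.Quotient.mk 1)) hb
      refine this.trans ?_
      change (1 : R) • c = c
      simp
  · intro H t e
    obtain ⟨c, hc⟩ := Abelian.Ext.covariant_sequence_exact₁ _ (ses hf hg h) e (Abelian.Ext.eq_zero_of_injective (n := 0) _) (zero_add 1)
    obtain ⟨u, rfl⟩ := Abelian.Ext.mk₀_bijective _ _ |>.surjective c
    obtain ⟨b, ⟨s, hs⟩, hb⟩ := H (u.hom (Submodule.Quotient.mk 1)) ⟨t, fun y hy => by
      rw [← map_smul, ← Submodule.Quotient.mk_smul, (Submodule.Quotient.mk_eq_zero _).mpr (by simpa using hy), map_zero]⟩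
    let v : ModuleCat.of R (R ⧸ I ^ (max t s)) ⟶ ModuleCat.of R B :=
      ModuleCat.ofHom (Submodule.liftQ (I ^ (max t s)) (LinearMap.toSpanSingleton R B b)
        (fun y hy => hs y (Ideal.pow_le_pow_right (le_max_right t s) hy)))
    refine ⟨max t s, le_max_left _ _, ?_⟩
    have h3 : resM I (le_max_left t s) ≫ u = v ≫ ModuleCat.ofHom g := by
      ext
      change u.hom (Submodule.Quotient.mk 1) = g ((1:R) • b)
      rw [one_smul, hb]
    rw [← hc, ← Abelian.Ext.comp_assoc (h₁₂ := zero_add _) (h₂₃ := zero_add _) (h := by lia), Abelian.Ext.mk₀_comp_mk₀]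
    erw [h3]
    rw [← Abelian.Ext.mk₀_comp_mk₀, Abelian.Ext.comp_assoc (h₁₂ := zero_add _) (h₂₃ := zero_add _) (h := by lia)]
    erw [(ses hf hg h).comp_extClass]
    simp

end les


section bound
variable {R : Type} [CommRing R]

def XTors (x : R) (A : Type) [AddCommGroup A] [Module R A] : Prop := ∀ a : A, ∃ k : ℕ, x ^ k • a = 0

def xtors (x : R) (A : Type) [AddCommGroup A] [Module R A] : Submodule R A where
  carrier := {a | ∃ k : ℕ, x ^ k • a = 0}
  zero_mem' := ⟨0, by simp⟩
  add_mem' := by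
    rintro a b ⟨k, hk⟩ ⟨l, hl⟩
    refine ⟨k + l, ?_⟩
    rw [smul_add, pow_add, mul_smul, mul_smul, hl, smul_comm, hk]; simp
  smul_mem' := by
    rintro r a ⟨k, hk⟩
    exact ⟨k, by rw [smul_comm, hk, smul_zero]⟩

variable {A B C : Type} [AddCommGroup A] [Module R A] [AddCommGroup B] [Module R B] [AddCommGroup C] [Module R C]

lemma xtors_XTors (x : R) : XTors x (xtors x A) := by
  rintro ⟨a, k, hk⟩
  exact ⟨k, Subtype.ext hk⟩

lemma XTors_uniform (x : R) [Module.Finite R A] (h : XTors x A) : ∃ k : ℕ, ∀ a : A, x ^ k • a = 0 := by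
  obtain ⟨s, hs⟩ := Module.Finite.fg_top (R := R) (M := A)
  choose k hk using h
  refine ⟨s.sup k, fun a => ?_⟩
  have ha : a ∈ Submodule.span R (s : Set A) := by rw [hs]; trivial
  induction ha using Submodule.span_induction with
  | mem a ha =>
    have : k a ≤ s.sup k := Finset.le_sup ha
    obtain ⟨d, hd⟩ := Nat.exists_eq_add_of_le this
    rw [hd, add_comm, pow_add, mul_smul, hk, smul_zero]
  | zero => simp
  | add a b _ _ h1 h2 => rw [smul_add, h1, h2, add_zero]
  | smul r a _ h1 => rw [smul_comm, h1, smul_zero]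

lemma xtors_injective [IsNoetherianRing R] (x : R) [Module.Injective R A] : Module.Injective R (xtors x A) := by
  rw [← Module.Baer.iff_injective]
  intro J f
  have hX : XTors x (LinearMap.range f) := by
    rintro ⟨a, ha⟩
    obtain ⟨k, hk⟩ := xtors_XTors x a
    exact ⟨k, Subtype.ext hk⟩
  obtain ⟨k, hk⟩ := XTors_uniform x hX
  have hk' : ∀ j, x ^ k • f j = 0 := fun j => congrArg Subtype.val (hk ⟨f j, j, rfl⟩)
  obtain ⟨n0, hn⟩ := Ideal.exists_pow_inf_eq_pow_smul (M := R) (Ideal.span {x}) J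
  have hn := hn (k + n0) (by lia)
  have hJ : ∀ y (hy : y ∈ J), x ^ (k + n0) ∣ y → f ⟨y, hy⟩ = 0 := by
    intro y hy hd
    have h1 : y ∈ Ideal.span {x} ^ (k + n0) • (⊤ : Submodule R R) ⊓ J := by
      refine ⟨?_, hy⟩
      rw [Ideal.span_singleton_pow]
      simpa [Ideal.mem_span_singleton] using hd
    rw [hn, Nat.add_sub_cancel, Ideal.span_singleton_pow, Submodule.ideal_span_singleton_smul] at h1
    obtain ⟨z, hz, hzy⟩ := h1
    have hz : z ∈ J := hz.2
    have : (⟨y, hy⟩ : J) = x ^ k • ⟨z, hz⟩ := Subtype.ext hzy.symm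
    rw [this, map_smul, hk']
  let q : J →ₗ[R] (R ⧸ Ideal.span {x ^ (k + n0)}) := (Submodule.mkQ _).comp J.subtype
  have hq : LinearMap.ker q ≤ LinearMap.ker ((xtors x A).subtype.comp f) := by
    rintro ⟨y, hy⟩ h
    have h : y ∈ Ideal.span {x ^ (k + n0)} := by
      exact Ideal.Quotient.eq_zero_iff_mem.mp h
    rw [Ideal.mem_span_singleton] at h
    simp [hJ y hy h]
  obtain ⟨H, hH⟩ := Module.Injective.out (R := R) (Q := A) ((LinearMap.ker q).liftQ q le_rfl)
    (by rw [← LinearMap.ker_eq_bot]; exact Submodule.ker_liftQ_eq_bot _ _ _ le_rfl)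
    ((LinearMap.ker q).liftQ _ hq)
  have hmem : ∀ r, H.comp (Submodule.mkQ _) r ∈ xtors x A := by
    intro r
    refine ⟨k + n0, ?_⟩
    rw [← map_smul, LinearMap.comp_apply, Submodule.mkQ_apply, (Submodule.Quotient.mk_eq_zero _).mpr, map_zero]
    exact Ideal.mem_span_singleton.mpr ⟨r, rfl⟩
  refine ⟨LinearMap.codRestrict _ _ hmem, fun y hy => Subtype.ext ?_⟩
  exact hH (Submodule.Quotient.mk ⟨y, hy⟩)

lemma exists_embed (M : Type) [AddCommGroup M] [Module R M] : ∃ (E : Type) (_ : AddCommGroup E) (_ : Module R E)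
    (f : M →ₗ[R] E), Module.Injective R E ∧ Function.Injective f := by
  let X : ModuleCat.{0} R := ModuleCat.of R M
  let U : ModuleCat.{0} R := Injective.under X
  let j : X ⟶ U := Injective.ι X
  have hU : Injective (ModuleCat.of R U) := inferInstanceAs (Injective (Injective.under X))
  have hj : Mono j := inferInstanceAs (Mono (Injective.ι X))
  exact ⟨U, inferInstance, inferInstance, j.hom, Module.injective_module_of_injective_object R _,
    (ModuleCat.mono_iff_injective _).mp hj⟩

lemma exists_embed_x [IsNoetherianRing R] (x : R) (M : Type) [AddCommGroup M] [Module R M] (h : XTors x M) :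
    ∃ (E : Type) (_ : AddCommGroup E) (_ : Module R E)
    (f : M →ₗ[R] E), Module.Injective R E ∧ Function.Injective f ∧ XTors x E := by
  obtain ⟨E, _, _, f, hE, hf⟩ := exists_embed (R := R) M
  refine ⟨xtors x E, inferInstance, inferInstance, f.codRestrict _ ?_, xtors_injective x, ?_, xtors_XTors x⟩
  · intro m
    obtain ⟨k, hk⟩ := h m
    exact ⟨k, by rw [← map_smul, hk, map_zero]⟩
  · intro a b hab
    exact hf (congrArg Subtype.val hab)

lemma XTors.of_surj {x : R} (h : XTors x A) (g : A →ₗ[R] B) (hg : Function.Surjective g) : XTors x B := by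
  intro b
  obtain ⟨a, rfl⟩ := hg b
  obtain ⟨k, hk⟩ := h a
  exact ⟨k, by rw [← map_smul, hk, map_zero]⟩

lemma torsBy_sup (b : Ideal R) (x : R) (h : XTors x A) (a : A) :
    TorsBy (b ⊔ Ideal.span {x}) a ↔ TorsBy b a := by
  constructor
  · rintro ⟨t, ht⟩
    exact ⟨t, fun y hy => ht y (Ideal.pow_right_mono le_sup_left t hy)⟩
  · rintro ⟨t, ht⟩
    obtain ⟨k, hk⟩ := h a
    refine ⟨t + k, fun y hy => ?_⟩
    have h1 := Ideal.sup_pow_add_le_pow_sup_pow (I := b) (J := Ideal.span {x}) (n := t) (m := k) hy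
    obtain ⟨u, hu, v, hv, rfl⟩ := Submodule.mem_sup.mp h1
    rw [Ideal.span_singleton_pow, Ideal.mem_span_singleton] at hv
    obtain ⟨w, rfl⟩ := hv
    rw [add_smul, ht u hu, mul_comm, mul_smul, hk]; simp

lemma VV_sup_of_XTors [IsNoetherianRing R] (b : Ideal R) (x : R) (i : ℕ) : ∀ (M : Type) [AddCommGroup M] [Module R M],
    XTors x M → VV b (i + 1) M → VV (b ⊔ Ideal.span {x}) (i + 1) M := by
  induction i with
  | zero =>
    intro M _ _ hM hV
    obtain ⟨E, _, _, f, hE, hf, hx⟩ := exists_embed_x x M hM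
    have hC : XTors x (E ⧸ LinearMap.range f) := hx.of_surj _ (Submodule.mkQ_surjective _)
    have hex := LinearMap.exact_map_mkQ_range f
    have h1 := (VV_one_iff b hf (Submodule.mkQ_surjective _) hex).mp hV
    refine (VV_one_iff _ hf (Submodule.mkQ_surjective _) hex).mpr fun c hc => ?_
    obtain ⟨e, he, hec⟩ := h1 c ((torsBy_sup b x hC c).mp hc)
    exact ⟨e, (torsBy_sup b x hx e).mpr he, hec⟩
  | succ i ih =>
    intro M _ _ hM hV
    obtain ⟨E, _, _, f, hE, hf, hx⟩ := exists_embed_x x M hM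
    have hC : XTors x (E ⧸ LinearMap.range f) := hx.of_surj _ (Submodule.mkQ_surjective _)
    have hex := LinearMap.exact_map_mkQ_range f
    have h1 := VV_right b (i+1) hf (Submodule.mkQ_surjective _) hex (VV_injective b i) hV
    exact VV_left _ (i+1) hf (Submodule.mkQ_surjective _) hex (ih _ hC h1) (VV_injective _ _)

lemma VV_bot (i : ℕ) (M : Type) [AddCommGroup M] [Module R M] : VV (⊥ : Ideal R) (i + 1) M := by
  intro t e
  refine ⟨t + 1, by lia, ?_⟩
  have h0 : (⊥ : Ideal R) ^ (t+1) = ⊥ := by simp [pow_succ]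
  have eq : (R ⧸ (⊥ : Ideal R) ^ (t+1)) ≃ₗ[R] R :=
    (Submodule.quotEquivOfEqBot _ h0)
  have : Module.Projective R (R ⧸ (⊥ : Ideal R) ^ (t+1)) := Module.Projective.of_equiv eq.symm
  have : Projective (ModuleCat.of R (R ⧸ (⊥ : Ideal R) ^ (t+1))) := (IsProjective.iff_projective _).mp this
  exact Abelian.Ext.eq_zero_of_projective _

lemma bound_step [IsNoetherianRing R] (b : Ideal R) (x : R) (r : ℕ)
    (hb : ∀ (M : Type) [AddCommGroup M] [Module R M], ∀ i > r, VV b i M)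
    (M : Type) [AddCommGroup M] [Module R M] (i : ℕ) (hi : i > r + 1) : VV (b ⊔ Ideal.span {x}) i M := by
  have hx : x ∈ b ⊔ Ideal.span {x} := (le_sup_right : _ ≤ b ⊔ Ideal.span {x}) (Ideal.mem_span_singleton_self x)
  have key : ∀ (N : Type) [AddCommGroup N] [Module R N], XTors x N → ∀ i > r, VV (b ⊔ Ideal.span {x}) i N := by
    intro N _ _ hN i hi
    obtain ⟨j, rfl⟩ : ∃ j, i = j + 1 := ⟨i - 1, by lia⟩
    exact VV_sup_of_XTors b x j N hN (hb N _ hi)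
  let L := LocalizedModule (Submonoid.powers x) M
  let φ : M →ₗ[R] L := LocalizedModule.mkLinearMap (Submonoid.powers x) M
  have hker : XTors x (LinearMap.ker φ) := by
    rintro ⟨m, hm⟩
    obtain ⟨⟨_, k, rfl⟩, hc⟩ := (IsLocalizedModule.eq_zero_iff (Submonoid.powers x) φ).mp hm
    exact ⟨k, Subtype.ext hc⟩
  have hQ : XTors x (L ⧸ LinearMap.range φ) := by
    intro q
    obtain ⟨l, rfl⟩ := Submodule.mkQ_surjective _ q
    obtain ⟨⟨m, ⟨_, k, rfl⟩⟩, hm⟩ := IsLocalizedModule.surj (Submonoid.powers x) φ l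
    refine ⟨k, ?_⟩
    rw [← map_smul, Submodule.mkQ_apply, Submodule.Quotient.mk_eq_zero]
    exact ⟨m, hm.symm⟩
  have hL : ∀ i, VV (b ⊔ Ideal.span {x}) i L := by
    intro i
    refine VV_bijective _ _ x hx ?_
    have := IsLocalizedModule.map_units (S := Submonoid.powers x) φ ⟨x, Submonoid.mem_powers x⟩
    exact (Module.End.isUnit_iff _).mp this
  obtain ⟨j, rfl⟩ : ∃ j, i = j + 1 := ⟨i - 1, by lia⟩
  have hR : VV (b ⊔ Ideal.span {x}) (j + 1) (LinearMap.range φ) :=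
    VV_left _ j (Submodule.injective_subtype _) (Submodule.mkQ_surjective _)
      (LinearMap.exact_subtype_mkQ _) (key _ hQ j (by lia)) (hL _)
  exact VV_ext _ (j+1) (f := (LinearMap.ker φ).subtype) (g := φ.rangeRestrict) (Submodule.injective_subtype _)
    φ.surjective_rangeRestrict (by
      rw [LinearMap.exact_iff, LinearMap.ker_rangeRestrict, Submodule.range_subtype]) (key _ hker _ (by lia)) hR

lemma VV_bound [IsNoetherianRing R] (I : Ideal R) :
    ∃ r : ℕ, ∀ (M : Type) [AddCommGroup M] [Module R M], ∀ i > r, VV I i M := by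
  obtain ⟨s, rfl⟩ := IsNoetherian.noetherian I
  classical
  induction s using Finset.induction_on with
  | empty =>
    refine ⟨0, fun M _ _ i hi => ?_⟩
    obtain ⟨j, rfl⟩ : ∃ j, i = j + 1 := ⟨i - 1, by lia⟩
    simpa using VV_bot j M
  | insert x s _ ih =>
    obtain ⟨r, hr⟩ := ih
    refine ⟨r + 1, fun M _ _ i hi => ?_⟩
    have := bound_step _ x r hr M i hi
    rwa [Finset.coe_insert, Submodule.span_insert, sup_comm]

end bound


section cdth
variable {R : Type} [CommRing R] [IsNoetherianRing R]
variable {A B C : Type} [AddCommGroup A] [Module R A] [AddCommGroup B] [Module R B] [AddCommGroup C] [Module R C]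

def PP (I : Ideal R) (n : ℕ) (M : Type) [AddCommGroup M] [Module R M] : Prop := ∀ i > n, VV I i M

lemma cohDim_le_iff (I : Ideal R) (n : ℕ) : cohDim I A ≤ n ↔ PP I n A := by
  obtain ⟨r, hr⟩ := VV_bound I
  have hmem : ∀ i, Nontrivial ((localCohomology I (i+1)).obj (ModuleCat.of R A)) ↔ ¬ VV I (i+1) A := by
    intro i
    rw [VV_iff, not_subsingleton_iff_nontrivial]
  have hbd : BddAbove {i : ℕ | Nontrivial ((localCohomology I i).obj (ModuleCat.of R A))} := by
    refine ⟨r, fun i hi => ?_⟩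
    by_contra h
    obtain ⟨j, rfl⟩ : ∃ j, i = j + 1 := ⟨i - 1, by lia⟩
    exact (hmem j).mp hi (hr A _ (by lia))
  constructor
  · intro h i hi
    obtain ⟨j, rfl⟩ : ∃ j, i = j + 1 := ⟨i - 1, by lia⟩
    by_contra hV
    have := le_csSup hbd ((hmem j).mpr hV)
    have h2 : cohDim I A = sSup {i : ℕ | Nontrivial ((localCohomology I i).obj (ModuleCat.of R A))} := rfl
    lia
  · intro h
    rcases Set.eq_empty_or_nonempty {i : ℕ | Nontrivial ((localCohomology I i).obj (ModuleCat.of R A))} with he | hne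
    · rw [cohDim, he]; simp
    · refine csSup_le hne fun i hi => ?_
      by_contra hin
      obtain ⟨j, rfl⟩ : ∃ j, i = j + 1 := ⟨i - 1, by lia⟩
      exact (hmem j).mp hi (h _ (by lia))

lemma VV_of_primes (I : Ideal R) (i : ℕ) (N : Type) [AddCommGroup N] [Module R N] (hfin : Module.Finite R N)
    (h : ∀ p ∈ Module.support R N, VV I i (R ⧸ p.asIdeal)) : VV I i N := by
  revert h
  induction hfin using IsNoetherianRing.induction_on_isQuotientEquivQuotientPrime R with
  | subsingleton N => intro _; exact VV_subsingleton I i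
  | quotient N p e =>
    intro h
    have hp : p ∈ Module.support R N := by
      rw [e.support_eq, Module.mem_support_iff_of_finite, Ideal.annihilator_quotient]
    exact VV_equiv I i e.symm (h p hp)
  | exact N₁ N₂ N₃ f g hf hg hfg h1 h3 =>
    intro h
    have hs := Module.support_of_exact hfg hf hg
    exact VV_ext I i hf hg hfg (h1 fun p hp => h p (by rw [hs]; exact Or.inl hp))
      (h3 fun p hp => h p (by rw [hs]; exact Or.inr hp))

lemma exists_hom (M : Type) [AddCommGroup M] [Module R M] [Module.Finite R M] (p : PrimeSpectrum R)
    (hp : p ∈ Module.support R M) : ∃ f : M →ₗ[R] (R ⧸ p.asIdeal), f ≠ 0 := by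
  let S : Set (Submodule R M) := {K | p.asIdeal • ⊤ ≤ K ∧ p ∈ Module.support R (M ⧸ K)}
  have hS : S.Nonempty := ⟨p.asIdeal • ⊤, le_rfl, by
    rw [Module.support_quotient]; exact ⟨hp, by simp⟩⟩
  obtain ⟨K, ⟨hK1, hK2⟩, hmax⟩ := wellFounded_gt.has_min S hS
  rw [Module.mem_support_iff_of_finite] at hK2
  have hpK : ∀ r ∈ p.asIdeal, ∀ m : M, r • m ∈ K := fun r hr m => hK1 (Submodule.smul_mem_smul hr trivial)
  have hK2' : ∀ s : R, (∀ m : M, s • m ∈ K) → s ∈ p.asIdeal := by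
    intro s hs
    apply hK2
    rw [Module.mem_annihilator]
    intro q
    obtain ⟨m, rfl⟩ := Submodule.mkQ_surjective _ q
    rw [← map_smul, Submodule.mkQ_apply, Submodule.Quotient.mk_eq_zero]
    exact hs m
  have hbig : ∀ L : Submodule R M, K < L → ∃ s ∉ p.asIdeal, ∀ m : M, s • m ∈ L := by
    intro L hL
    by_contra! hcon
    refine hmax L ⟨hK1.trans hL.le, ?_⟩ hL
    rw [Module.mem_support_iff_of_finite]
    intro s hs
    by_contra hsp
    obtain ⟨m, hm⟩ := hcon s hsp
    rw [Module.mem_annihilator] at hs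
    have := hs (L.mkQ m)
    rw [← map_smul, Submodule.mkQ_apply, Submodule.Quotient.mk_eq_zero] at this
    exact hm this
  have hKtop : ∃ x : M, x ∉ K := by
    by_contra! h
    exact p.2.ne_top ((Ideal.eq_top_iff_one _).mpr (hK2' 1 fun m => h _))
  obtain ⟨x, hx⟩ := hKtop
  have hann : ∀ r, r • x ∈ K → r ∈ p.asIdeal := by
    intro r hr
    let T : Submodule R M := K.comap (LinearMap.lsmul R M r)
    have hKT : K < T := by
      refine lt_of_le_of_ne (fun m hm => K.smul_mem r hm) fun h => hx ?_
      rw [h]; exact hr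
    obtain ⟨s, hs, hsT⟩ := hbig T hKT
    have : r * s ∈ p.asIdeal := hK2' _ fun m => by
      rw [mul_smul]; exact hsT m
    exact (p.2.mem_or_mem this).resolve_right hs
  obtain ⟨s, hs, hsx⟩ := hbig (K ⊔ Submodule.span R {x}) (by
    refine lt_of_le_of_ne le_sup_left fun h => hx ?_
    rw [h]; exact (le_sup_right : _ ≤ K ⊔ Submodule.span R {x}) (Submodule.mem_span_singleton_self x))
  let g : (R ⧸ p.asIdeal) →ₗ[R] (M ⧸ K) := Submodule.liftQ p.asIdeal (LinearMap.toSpanSingleton R _ (K.mkQ x))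
    (fun r hr => by
      change r • K.mkQ x = 0
      rw [← map_smul, Submodule.mkQ_apply, Submodule.Quotient.mk_eq_zero]
      exact hpK r hr x)
  have hg : Function.Injective g := by
    rw [← LinearMap.ker_eq_bot]
    apply Submodule.ker_liftQ_eq_bot
    intro r hr
    change r • K.mkQ x = 0 at hr
    rw [← map_smul, Submodule.mkQ_apply, Submodule.Quotient.mk_eq_zero] at hr
    exact hann r hr
  let φ : M →ₗ[R] (M ⧸ K) := s • K.mkQ
  have hφ : ∀ m, φ m ∈ LinearMap.range g := by
    intro m
    obtain ⟨k, hk, y, hy, hky⟩ := Submodule.mem_sup.mp (hsx m)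
    obtain ⟨r, rfl⟩ := Submodule.mem_span_singleton.mp hy
    refine ⟨Submodule.Quotient.mk r, ?_⟩
    change r • K.mkQ x = s • K.mkQ m
    rw [← map_smul, ← map_smul, ← hky, map_add]
    have : K.mkQ k = 0 := by simpa using hk
    rw [this, zero_add]
  refine ⟨(LinearEquiv.ofInjective g hg).symm.toLinearMap.comp (φ.codRestrict _ hφ), fun h => ?_⟩
  have h1 : ∀ m, φ m = 0 := by
    intro m
    have := LinearMap.congr_fun h m
    simp only [LinearMap.comp_apply, LinearEquiv.coe_coe, LinearMap.zero_apply, LinearEquiv.map_eq_zero_iff] at this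
    exact congrArg Subtype.val this
  refine hs (hK2' s fun m => ?_)
  have := h1 m
  change s • K.mkQ m = 0 at this
  rwa [← map_smul, Submodule.mkQ_apply, Submodule.Quotient.mk_eq_zero] at this

lemma VV_step (I : Ideal R) (i : ℕ) (M : Type) [AddCommGroup M] [Module R M] [Module.Finite R M]
    (hM : VV I i M)
    (hnext : ∀ (N : Type) [AddCommGroup N] [Module R N] [Module.Finite R N],
      Module.support R N ⊆ Module.support R M → VV I (i+1) N)
    (N : Type) [AddCommGroup N] [Module R N] [hfin : Module.Finite R N]
    (hN : Module.support R N ⊆ Module.support R M) : VV I i N := by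
  have key : ∀ J : Ideal R, ∀ p : PrimeSpectrum R, p.asIdeal = J → p ∈ Module.support R M → VV I i (R ⧸ p.asIdeal) := by
    intro J
    induction J using (wellFounded_gt (α := Ideal R)).induction with | _ J ih
    rintro p rfl hp
    obtain ⟨f, hf⟩ := exists_hom M p hp
    have hrange : VV I i (LinearMap.range f) := by
      refine VV_right I i (f := (LinearMap.ker f).subtype) (g := f.rangeRestrict) (Submodule.injective_subtype _)
        f.surjective_rangeRestrict (by
        rw [LinearMap.exact_iff, LinearMap.ker_rangeRestrict, Submodule.range_subtype]) hM (hnext _ ?_)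
      exact Module.support_subset_of_injective _ (Submodule.injective_subtype _)
    obtain ⟨m, hm⟩ : ∃ m, f m ≠ 0 := by
      by_contra! h
      exact hf (LinearMap.ext h)
    obtain ⟨y, hy⟩ := Submodule.mkQ_surjective p.asIdeal (f m)
    have hyp : y ∉ p.asIdeal := fun h => hm (by rw [← hy]; exact (Submodule.Quotient.mk_eq_zero _).mpr h)
    have hcok : VV I i ((R ⧸ p.asIdeal) ⧸ LinearMap.range f) := by
      refine VV_of_primes I i _ inferInstance fun q hq => ?_
      rw [Module.mem_support_iff_of_finite] at hq
      have hpq : p.asIdeal ≤ q.asIdeal := by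
        intro r hr
        apply hq
        rw [Module.mem_annihilator]
        intro z
        obtain ⟨z, rfl⟩ := Submodule.mkQ_surjective _ z
        obtain ⟨z, rfl⟩ := Submodule.mkQ_surjective _ z
        rw [← map_smul, ← map_smul]
        have : p.asIdeal.mkQ (r • z) = 0 := by
          rw [Submodule.mkQ_apply, Submodule.Quotient.mk_eq_zero]
          exact p.asIdeal.mul_mem_right z hr
        rw [this, map_zero]
      have hyq : y ∈ q.asIdeal := by
        apply hq
        rw [Module.mem_annihilator]
        intro z
        obtain ⟨z, rfl⟩ := Submodule.mkQ_surjective _ z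
        obtain ⟨z, rfl⟩ := Submodule.mkQ_surjective _ z
        rw [← map_smul, ← map_smul, smul_eq_mul, mul_comm, ← smul_eq_mul, map_smul, hy, Submodule.mkQ_apply,
          Submodule.Quotient.mk_eq_zero]
        exact ⟨z • m, map_smul _ _ _⟩
      refine ih q.asIdeal (lt_of_le_of_ne hpq fun h => hyp (h ▸ hyq)) q rfl ?_
      exact Module.mem_support_mono hpq hp
    exact VV_ext I i (Submodule.injective_subtype _) (Submodule.mkQ_surjective _)
      (LinearMap.exact_subtype_mkQ _) hrange hcok
  exact VV_of_primes I i N hfin fun p hp => key _ p rfl (hN hp)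

theorem PP_support (I : Ideal R) (n : ℕ) (M : Type) [AddCommGroup M] [Module R M] [Module.Finite R M]
    (hM : PP I n M) (N : Type) [AddCommGroup N] [Module R N] [Module.Finite R N]
    (hN : Module.support R N ⊆ Module.support R M) : PP I n N := by
  obtain ⟨r, hr⟩ := VV_bound I
  have key : ∀ d i : ℕ, i > n → i + d > r → ∀ (N : Type) [AddCommGroup N] [Module R N] [Module.Finite R N],
      Module.support R N ⊆ Module.support R M → VV I i N := by
    intro d
    induction d with
    | zero => intro i _ hi N _ _ _ _; exact hr N i hi
    | succ d ih =>
      intro i hi hd N _ _ _ hN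
      exact VV_step I i M (hM i hi) (ih (i+1) (by lia) (by lia)) N hN
  intro i hi
  exact key (r+1) i hi (by lia) N hN

lemma PP_ext (I : Ideal R) (n : ℕ) {f : A →ₗ[R] B} {g : B →ₗ[R] C} (hf : Function.Injective f)
    (hg : Function.Surjective g) (h : Function.Exact f g) (hA : PP I n A) (hC : PP I n C) : PP I n B :=
  fun i hi => VV_ext I i hf hg h (hA i hi) (hC i hi)

lemma PP_of_inj (I : Ideal R) (n : ℕ) [Module.Finite R B] (f : A →ₗ[R] B) (hf : Function.Injective f)
    (hB : PP I n B) : PP I n A := by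
  have : Module.Finite R A := Module.Finite.of_injective f hf
  exact PP_support I n B hB A (Module.support_subset_of_injective f hf)

lemma PP_of_surj (I : Ideal R) (n : ℕ) [Module.Finite R A] (f : A →ₗ[R] B) (hf : Function.Surjective f)
    (hA : PP I n A) : PP I n B := by
  have : Module.Finite R B := Module.Finite.of_surjective f hf
  exact PP_support I n A hA B (Module.support_subset_of_surjective f hf)

lemma PP_mono (I : Ideal R) {n m : ℕ} (h : n ≤ m) (hA : PP I n A) : PP I m A := fun i hi => hA i (by lia)

lemma ass_embed {p : Ideal R} (hp : p ∈ associatedPrimes R A) :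
    ∃ f : (R ⧸ p) →ₗ[R] A, Function.Injective f := by
  obtain ⟨x, hx⟩ := (isAssociatedPrime_iff_exists_injective_linearMap _ _).mp hp |>.2
  exact ⟨x, hx⟩

lemma PP_of_mem_ass (I : Ideal R) (n : ℕ) [Module.Finite R A] (hA : PP I n A) {p : Ideal R}
    (hp : p ∈ associatedPrimes R A) : PP I n (R ⧸ p) := by
  obtain ⟨f, hf⟩ := ass_embed hp
  exact PP_of_inj I n f hf hA

lemma PP_of_ass (I : Ideal R) (n : ℕ) [hfin : Module.Finite R A]
    (h : ∀ p ∈ associatedPrimes R A, PP I n (R ⧸ p)) : PP I n A := by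
  intro i hi
  refine VV_of_primes I i A hfin fun q hq => ?_
  rw [Module.mem_support_iff_of_finite] at hq
  obtain ⟨p, hp, hpq⟩ := Ideal.exists_minimalPrimes_le hq
  have hpA : p ∈ associatedPrimes R A := Module.associatedPrimes.minimalPrimes_annihilator_subset_associatedPrimes R A hp
  refine PP_support I n (R ⧸ p) (h p hpA) (R ⧸ q.asIdeal) ?_ i hi
  exact Module.support_subset_of_surjective (Submodule.factor hpq) (Submodule.factor_surjective hpq)

end cdth


section fin
variable {R : Type} [CommRing R] [IsNoetherianRing R]
variable {M : Type} [AddCommGroup M] [Module R M] [Module.Finite R M]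

lemma ass_factor (I : Ideal R) (j : ℕ) (G H : Submodule R M) (hGH : G ≤ H) (hG : PP I j G) (hH : PP I (j+1) H)
    (maxG : ∀ N : Submodule R M, PP I j N → N ≤ G) (maxH : ∀ N : Submodule R M, PP I (j+1) N → N ≤ H) :
    associatedPrimes R (H ⧸ Submodule.comap H.subtype G) =
      {p ∈ associatedPrimes R M | PP I (j+1) (R ⧸ p) ∧ ¬ PP I j (R ⧸ p)} := by
  let K := Submodule.comap H.subtype G
  ext p
  constructor
  · intro hp
    have hpp : p.IsPrime := hp.1
    obtain ⟨u, hu⟩ := ass_embed hp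
    have h1 : PP I (j+1) (H ⧸ K) := PP_of_surj I (j+1) K.mkQ (Submodule.mkQ_surjective _) hH
    have h2 : PP I (j+1) (R ⧸ p) := PP_of_mem_ass I (j+1) h1 hp
    let N : Submodule R H := (LinearMap.range u).comap K.mkQ
    have hKN : ∀ x : G, (Submodule.inclusion hGH x) ∈ N := by
      intro x
      refine ⟨0, ?_⟩
      rw [map_zero, eq_comm, Submodule.mkQ_apply, Submodule.Quotient.mk_eq_zero]
      exact x.2
    let f : G →ₗ[R] N := (Submodule.inclusion hGH).codRestrict N hKN
    let g : N →ₗ[R] LinearMap.range u := (K.mkQ.comp N.subtype).codRestrict _ (fun n => n.2)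
    have hf : Function.Injective f := by
      intro a b hab
      exact Subtype.ext (congrArg (fun z : N => ((z : H) : M)) hab)
    have hg : Function.Surjective g := by
      rintro ⟨q, hq⟩
      obtain ⟨x, rfl⟩ := Submodule.mkQ_surjective _ q
      exact ⟨⟨x, hq⟩, rfl⟩
    have hfg : Function.Exact f g := by
      rintro ⟨x, hx⟩
      constructor
      · intro h
        have h := congrArg Subtype.val h
        change K.mkQ x = 0 at h
        rw [Submodule.mkQ_apply, Submodule.Quotient.mk_eq_zero] at h
        exact ⟨⟨x, h⟩, rfl⟩
      · rintro ⟨y, hy⟩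
        have hy : (y : M) = x := congrArg (fun z : N => ((z : H) : M)) hy
        apply Subtype.ext
        change K.mkQ x = 0
        rw [Submodule.mkQ_apply, Submodule.Quotient.mk_eq_zero]
        change (x : M) ∈ G
        rw [← hy]; exact y.2
    have hN : ¬ PP I j N := by
      intro hN
      have e : N ≃ₗ[R] N.map H.subtype := N.equivMapOfInjective _ (Submodule.injective_subtype _)
      have h3 := maxG _ (PP_of_surj I j e.toLinearMap e.surjective hN)
      obtain ⟨x, hx⟩ := Submodule.mkQ_surjective _ (u 1)
      have hxN : x ∈ N := ⟨1, hx.symm⟩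
      have hxG : (x : M) ∈ G := h3 ⟨x, hxN, rfl⟩
      have : u 1 = 0 := by
        rw [← hx, Submodule.mkQ_apply, Submodule.Quotient.mk_eq_zero]; exact hxG
      have h10 : (1 : R ⧸ p) = 0 := hu (by rw [this, map_zero])
      exact one_ne_zero h10
    have er : (R ⧸ p) ≃ₗ[R] LinearMap.range u := LinearEquiv.ofInjective u hu
    refine ⟨?_, h2, fun h3 => hN (PP_ext I j hf hg hfg hG (PP_of_surj I j er.toLinearMap er.surjective h3))⟩
    by_contra hpM
    refine hN (PP_of_ass I j fun q hq => ?_)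
    rcases associatedPrimes.subset_union_of_exact hf hfg hq with h | h
    · exact PP_of_mem_ass I j hG h
    · exfalso
      rw [← LinearEquiv.AssociatedPrimes.eq er, associatedPrimes.eq_singleton_of_isPrimary hpp.isPrimary, hpp.radical] at h
      rw [Set.mem_singleton_iff] at h
      subst h
      exact hpM (associatedPrimes.subset_of_injective (f := H.subtype.comp N.subtype)
        ((Submodule.injective_subtype _).comp (Submodule.injective_subtype _)) hq)
  · rintro ⟨hp, h1, h2⟩
    have hpp : p.IsPrime := hp.1
    obtain ⟨f, hf⟩ := ass_embed hp
    have hfH : ∀ y, f y ∈ H := by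
      intro y
      exact maxH (LinearMap.range f) (PP_of_surj I (j+1) f.rangeRestrict f.surjective_rangeRestrict h1) ⟨y, rfl⟩
    refine (isAssociatedPrime_iff_exists_injective_linearMap _ _).mpr ⟨hpp, K.mkQ.comp (f.codRestrict H hfH), ?_⟩
    rw [injective_iff_map_eq_zero]
    intro y hy
    by_contra hy0
    rw [LinearMap.comp_apply, Submodule.mkQ_apply, Submodule.Quotient.mk_eq_zero] at hy
    have hy : f y ∈ G := hy
    obtain ⟨r, rfl⟩ := Submodule.mkQ_surjective _ y
    have hmem : ∀ z, f (r • z) ∈ G := by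
      intro z
      obtain ⟨z, rfl⟩ := Submodule.mkQ_surjective _ z
      have : r • p.mkQ z = z • p.mkQ r := by
        rw [← map_smul, ← map_smul, smul_eq_mul, smul_eq_mul, mul_comm]
      rw [this, map_smul]
      exact G.smul_mem _ hy
    refine h2 (PP_of_inj I j ((f.comp (LinearMap.lsmul R (R ⧸ p) r)).codRestrict G hmem) ?_ hG)
    rw [injective_iff_map_eq_zero]
    intro z hz
    have hz : f (r • z) = 0 := congrArg Subtype.val hz
    have hz : r • z = 0 := hf (by rw [hz, map_zero])
    have hz' : (Ideal.Quotient.mk p r) * z = 0 := by rw [← hz]; rfl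
    exact (mul_eq_zero.mp hz').resolve_left hy0

theorem main_thm (I : Ideal R) (c : ℕ)
    (F : ℕ → Submodule R M) (hmono : ∀ i j, i ≤ j → F i ≤ F j) (htop : F c = ⊤)
    (h0 : cohDim I ↥(F 0) = 0) :
    (∀ i, 1 ≤ i → i ≤ c →
        associatedPrimes R (filtFactor F i) =
          {p ∈ associatedPrimes R M | cohDim I (R ⧸ p) = i}) ↔
      IsCdFiltration I c F := by
  constructor
  · intro h
    have hPP : ∀ i ≤ c, PP I i (F i) := by
      intro i
      induction i with
      | zero => intro _; exact (cohDim_le_iff I 0).mp h0.le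
      | succ i ih =>
        intro hi
        have hle := hmono i (i+1) (by lia)
        let K := Submodule.comap (F (i+1)).subtype (F i)
        have hQ : PP I (i+1) (F (i+1) ⧸ K) := by
          refine PP_of_ass I (i+1) fun p hp => ?_
          have hp' : p ∈ associatedPrimes R (filtFactor F (i+1)) := hp
          rw [h (i+1) (by lia) hi] at hp'
          exact (cohDim_le_iff I (i+1)).mp hp'.2.le
        refine PP_ext I (i+1) (f := Submodule.inclusion hle) (g := K.mkQ) (Submodule.inclusion_injective hle)
          (Submodule.mkQ_surjective _) ?_ (PP_mono I (by lia) (ih (by lia))) hQ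
        rw [LinearMap.exact_iff, Submodule.ker_mkQ, Submodule.range_inclusion]
    intro i hi
    refine ⟨(cohDim_le_iff I i).mpr (hPP i hi), fun N hN => ?_⟩
    rw [cohDim_le_iff] at hN
    by_contra hNi
    have hex : ∃ j, N ≤ F j := ⟨c, by rw [htop]; exact le_top⟩
    classical
    let j := Nat.find hex
    have hj : N ≤ F j := Nat.find_spec hex
    have hjc : j ≤ c := Nat.find_min' hex (by rw [htop]; exact le_top)
    have hij : i < j := by
      by_contra hcon
      exact hNi (hj.trans (hmono _ _ (by lia)))
    have hj1 : ¬ N ≤ F (j - 1) := Nat.find_min hex (by lia)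
    let K := Submodule.comap (F j).subtype (F (j-1))
    let φ : N →ₗ[R] (F j ⧸ K) := K.mkQ.comp (Submodule.inclusion hj)
    obtain ⟨x, hxN, hx⟩ := SetLike.not_le_iff_exists.mp hj1
    have hφx : φ ⟨x, hxN⟩ ≠ 0 := by
      intro h
      change K.mkQ (Submodule.inclusion hj ⟨x, hxN⟩) = 0 at h
      rw [Submodule.mkQ_apply, Submodule.Quotient.mk_eq_zero] at h
      exact hx h
    have : Nontrivial (LinearMap.range φ) := ⟨⟨φ ⟨x, hxN⟩, _, rfl⟩, 0, fun h => hφx (congrArg Subtype.val h)⟩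
    obtain ⟨p, hp⟩ := associatedPrimes.nonempty R (LinearMap.range φ)
    have h1 : PP I i (R ⧸ p) :=
      PP_of_mem_ass I i (PP_of_surj I i φ.rangeRestrict φ.surjective_rangeRestrict hN) hp
    have h2 : p ∈ associatedPrimes R (filtFactor F j) :=
      associatedPrimes.subset_of_injective (f := (LinearMap.range φ).subtype) (Submodule.injective_subtype _) hp
    rw [h j (by lia) hjc] at h2
    have h3 := h2.2
    rw [← cohDim_le_iff] at h1
    lia
  · intro h i hi1 hic
    obtain ⟨j, rfl⟩ : ∃ j, i = j + 1 := ⟨i - 1, by lia⟩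
    obtain ⟨hG, maxG⟩ := h j (by lia)
    obtain ⟨hH, maxH⟩ := h (j+1) hic
    have := ass_factor I j (F j) (F (j+1)) (hmono _ _ (by lia)) ((cohDim_le_iff I _).mp hG) ((cohDim_le_iff I _).mp hH)
      (fun N hN => maxG N ((cohDim_le_iff I _).mpr hN)) (fun N hN => maxH N ((cohDim_le_iff I _).mpr hN))
    refine Eq.trans this ?_
    ext p
    simp only [Set.mem_ofPred_eq, ← cohDim_le_iff]
    refine and_congr_right fun _ => ?_
    lia

end fin


end helpers

/-- Theorem 2.13 (Theorem 1.4): for an increasing filtration `{M_i}_{i=0}^c` of `M` with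
`M_c = M` and `cd(𝔞,M₀) = 0`, the filtration is the cd-filtration of `M` iff
`Ass(M_i/M_{i−1}) = {𝔭 ∈ Ass M : cd(𝔞,R/𝔭) = i}` for all `1 ≤ i ≤ c`. -/
theorem stmt5 {R : Type} [CommRing R] [IsNoetherianRing R]
    (𝔞 : Ideal R) (h𝔞 : 𝔞 ≠ ⊤)
    (M : Type) [AddCommGroup M] [Module R M] [Module.Finite R M]
    (c : ℕ) (hc : c = cohDim 𝔞 M)
    (F : ℕ → Submodule R M) (hmono : ∀ i j, i ≤ j → F i ≤ F j) (htop : F c = ⊤)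
    (h0 : cohDim 𝔞 ↥(F 0) = 0) :
    (∀ i, 1 ≤ i → i ≤ c →
        associatedPrimes R (filtFactor F i) =
          {p ∈ associatedPrimes R M | cohDim 𝔞 (R ⧸ p) = i}) ↔
      IsCdFiltration 𝔞 c F := by
  exact main_thm 𝔞 c F hmono htop h0
end
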